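/- (Sobolev–Poincaré inequality for p > 1 in s(·)-John domains) Let D ⊆ ℝ^n, n ≥ 2, be an s(·)-John domain with 1 ≤ s⁻ ≤ s⁺ < n/(n−1) and 1 < p < n/(n − s⁻(n−1)). Then there exists a constant c such that ‖u − u_B‖_{L^{q(·)}(D)} ≤ c ‖∇u‖_{L^p(D)} for all u ∈ L^1_p(D), where q(x) = np/(pn(s(x)−1) + n − s(x)p) and B = B(x₀, dist(x₀, ∂D)). -/

import Mathlib

open MeasureTheory Metric

/-- `D` is an `s(·)`-John domain with John constants `a ≤ b` and John center `x₀`: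
every point of `D` is joined to `x₀` by a rectifiable curve, parametrized by arc
length (hence `1`-Lipschitz), of length at most `b`, along which
`t^{s(x)} ≤ (b/a) dist(γ t, ∂D)`. -/
def IsJohnDomain {n : ℕ} (D : Set (EuclideanSpace ℝ (Fin n)))
    (s : EuclideanSpace ℝ (Fin n) → ℝ) (a b : ℝ)
    (x₀ : EuclideanSpace ℝ (Fin n)) : Prop :=
  IsOpen D ∧ IsConnected D ∧ Bornology.IsBounded D ∧ 0 < a ∧ a ≤ b ∧ x₀ ∈ D ∧
    ∀ x ∈ D, ∃ ℓ : ℝ, 0 ≤ ℓ ∧ ℓ ≤ b ∧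
      ∃ γ : ℝ → EuclideanSpace ℝ (Fin n),
        γ 0 = x ∧ γ ℓ = x₀ ∧ LipschitzOnWith 1 γ (Set.Icc 0 ℓ) ∧
        (∀ t ∈ Set.Icc 0 ℓ, γ t ∈ D) ∧
        (∀ t ∈ Set.Icc 0 ℓ, t ^ s x ≤ (b / a) * Metric.infDist (γ t) (frontier D))

/-- The Luxemburg norm on the variable exponent Lebesgue space `L^{p(·)}(Ω)`. -/
noncomputable def luxNorm {n : ℕ} (p : EuclideanSpace ℝ (Fin n) → ℝ)
    (Ω : Set (EuclideanSpace ℝ (Fin n))) (f : EuclideanSpace ℝ (Fin n) → ℝ) : ℝ :=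
  sInf {l : ℝ | 0 < l ∧ ∫⁻ x in Ω, ENNReal.ofReal ((|f x| / l) ^ p x) ≤ 1}


namespace JSP
open Set Filter Topology
open scoped ENNReal NNReal

/-- Hardy-Littlewood maximal function over a sequence of radii. -/
noncomputable def maxFn {n : ℕ} (R : ℕ → ℝ) (F : EuclideanSpace ℝ (Fin n) → ℝ≥0∞)
    (x : EuclideanSpace ℝ (Fin n)) : ℝ≥0∞ :=
  ⨆ j, (∫⁻ y in closedBall x (R j), F y) / volume (closedBall x (R j))

lemma maxFn_measurable {n : ℕ} (R : ℕ → ℝ) (F : EuclideanSpace ℝ (Fin n) → ℝ≥0∞)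
    (hF : Measurable F) : Measurable (maxFn R F) := by
  unfold maxFn
  refine Measurable.iSup fun j => ?_
  have h1 : ∀ x : EuclideanSpace ℝ (Fin n),
      volume (closedBall x (R j)) = volume (closedBall (0 : EuclideanSpace ℝ (Fin n)) (R j)) :=
    fun x => Measure.addHaar_closedBall_center volume x (R j)
  simp_rw [h1]
  refine Measurable.div_const ?_ _
  have h2 : ∀ x : EuclideanSpace ℝ (Fin n), (∫⁻ y in closedBall x (R j), F y)
      = ∫⁻ y, ({q : EuclideanSpace ℝ (Fin n) × EuclideanSpace ℝ (Fin n) | dist q.2 q.1 ≤ R j}.indicator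
          (fun q => F q.2)) (x, y) := by
    intro x
    rw [← lintegral_indicator measurableSet_closedBall]
    congr 1
  simp_rw [h2]
  apply Measurable.lintegral_prod_right'
  refine Measurable.indicator (hF.comp measurable_snd) ?_
  exact measurableSet_le (measurable_snd.dist measurable_fst) measurable_const

lemma weak_type {n : ℕ} (R : ℕ → ℝ) (R0 : ℝ) (hR : ∀ j, 0 < R j) (hR0 : ∀ j, R j ≤ R0)
    (F : EuclideanSpace ℝ (Fin n) → ℝ≥0∞) (hF : Measurable F) (l : ℝ≥0∞) :
    l * volume {x | l < maxFn R F x} ≤ 5 ^ n * ∫⁻ y, F y := by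
  set S := {x | l < maxFn R F x} with hS
  have h1 : ∀ x : EuclideanSpace ℝ (Fin n), ∃ j, x ∈ S → l < (∫⁻ y in closedBall x (R j), F y) / volume (closedBall x (R j)) := by
    intro x
    by_cases hx : x ∈ S
    · have hx' : l < maxFn R F x := hx
      unfold maxFn at hx'
      obtain ⟨j, hj⟩ := lt_iSup_iff.1 hx'
      exact ⟨j, fun _ => hj⟩
    · exact ⟨0, fun h => absurd h hx⟩
  choose j hj using h1
  obtain ⟨u, huS, hdisj, hcov⟩ := Vitali.exists_disjoint_subfamily_covering_enlargement_closedBall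
    S (fun x => x) (fun x => R (j x)) R0 (fun x _ => hR0 _) 5 (by norm_num)
  have hcount : u.Countable := hdisj.countable_of_nonempty_interior fun x _ =>
    (nonempty_ball.2 (hR (j x))).mono ball_subset_interior_closedBall
  have hsub : S ⊆ ⋃ x ∈ u, closedBall x (5 * R (j x)) := by
    intro x hx
    obtain ⟨y, hy, hxy⟩ := hcov x hx
    exact mem_biUnion hy (hxy (mem_closedBall_self (hR _).le))
  have := hcount.to_subtype
  have hvol : ∀ x : EuclideanSpace ℝ (Fin n), volume (closedBall x (5 * R (j x)))
      = 5 ^ n * volume (closedBall x (R (j x))) := by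
    intro x
    have := Measure.addHaar_closedBall_mul (volume : Measure (EuclideanSpace ℝ (Fin n))) x
      (r := 5) (by norm_num) (s := R (j x)) (hR _).le
    rw [this, Measure.addHaar_closedBall_center volume x]
    simp [ENNReal.ofReal_pow]
  calc l * volume S ≤ l * ∑' x : u, volume (closedBall (x : EuclideanSpace ℝ (Fin n)) (5 * R (j x))) := by
        gcongr
        exact (measure_mono hsub).trans (measure_biUnion_le volume hcount _)
    _ = 5 ^ n * ∑' x : u, l * volume (closedBall (x : EuclideanSpace ℝ (Fin n)) (R (j x))) := by
        simp_rw [hvol]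
        rw [ENNReal.tsum_mul_left, ENNReal.tsum_mul_left]
        ring
    _ ≤ 5 ^ n * ∑' x : u, ∫⁻ y in closedBall (x : EuclideanSpace ℝ (Fin n)) (R (j x)), F y := by
        gcongr with x
        have := hj x (huS x.2)
        rw [ENNReal.lt_div_iff_mul_lt] at this
        · exact this.le
        · left; exact (measure_closedBall_pos volume _ (hR _)).ne'
        · left; exact measure_closedBall_lt_top.ne
    _ = 5 ^ n * ∫⁻ y in ⋃ x ∈ u, closedBall x (R (j x)), F y := by
        rw [lintegral_biUnion hcount (fun _ _ => measurableSet_closedBall) hdisj]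
    _ ≤ 5 ^ n * ∫⁻ y, F y := by
        gcongr
        exact Measure.restrict_le_self

lemma inner_int (p : ℝ) (hp : 1 < p) (A : ℝ) (hA : 0 ≤ A) :
    ∫⁻ t in Ioc 0 A, ENNReal.ofReal (t ^ (p - 2)) = ENNReal.ofReal (A ^ (p - 1) / (p - 1)) := by
  have hi : IntervalIntegrable (fun t : ℝ => t ^ (p - 2)) volume 0 A :=
    intervalIntegral.intervalIntegrable_rpow' (by linarith)
  rw [← ofReal_integral_eq_lintegral_ofReal]
  · rw [← intervalIntegral.integral_of_le hA, integral_rpow (by left; linarith)]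
    rw [Real.zero_rpow (by linarith)]
    congr 1
    rw [show p - 2 + 1 = p - 1 by ring]; simp
  · exact (intervalIntegrable_iff_integrableOn_Ioc_of_le hA).1 hi
  · filter_upwards [ae_restrict_mem measurableSet_Ioc] with t ht
    exact Real.rpow_nonneg ht.1.le _

lemma maxFn_split {n : ℕ} (R : ℕ → ℝ)
    (F : EuclideanSpace ℝ (Fin n) → ℝ≥0∞) (hF : Measurable F) (l : ℝ≥0∞)
    (x : EuclideanSpace ℝ (Fin n)) :
    maxFn R F x ≤ maxFn R ({y | l < F y}.indicator F) x + l := by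
  unfold maxFn
  refine iSup_le fun j => ?_
  have h1 : (∫⁻ y in closedBall x (R j), F y) ≤
      (∫⁻ y in closedBall x (R j), {y | l < F y}.indicator F y) + l * volume (closedBall x (R j)) := by
    rw [← setLIntegral_const, ← lintegral_add_left (hF.indicator (measurableSet_lt measurable_const hF))]
    apply lintegral_mono
    intro y
    by_cases hy : l < F y
    · simp [indicator, hy]
    · simp [indicator, hy]
      exact not_lt.1 hy
  calc _ ≤ ((∫⁻ y in closedBall x (R j), {y | l < F y}.indicator F y) + l * volume (closedBall x (R j)))
        / volume (closedBall x (R j)) := by gcongr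
    _ ≤ _ := by
      rw [ENNReal.add_div]
      gcongr
      · exact le_iSup (fun j => (∫⁻ y in closedBall x (R j), {y | l < F y}.indicator F y) / volume (closedBall x (R j))) j
      · exact ENNReal.div_le_of_le_mul le_rfl

lemma strong_type {n : ℕ} (R : ℕ → ℝ) (R0 : ℝ) (hR : ∀ j, 0 < R j) (hR0 : ∀ j, R j ≤ R0)
    (p : ℝ) (hp : 1 < p)
    (g : EuclideanSpace ℝ (Fin n) → ℝ) (hg : Measurable g) (hg0 : ∀ x, 0 ≤ g x)
    (hfin : ∫⁻ y, ENNReal.ofReal (g y) ≠ ∞) :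
    ∫⁻ x, (maxFn R (fun y => ENNReal.ofReal (g y)) x) ^ p
      ≤ ENNReal.ofReal (p * 5 ^ n * 2 * 2 ^ (p - 1) / (p - 1)) * ∫⁻ y, ENNReal.ofReal (g y) ^ p := by
  set F : EuclideanSpace ℝ (Fin n) → ℝ≥0∞ := fun y => ENNReal.ofReal (g y) with hFdef
  have hF : Measurable F := hg.ennreal_ofReal
  have hM : Measurable (maxFn R F) := maxFn_measurable R F hF
  have hae : ∀ᵐ x, maxFn R F x ≠ ∞ := by
    have h0 : volume {x | maxFn R F x = ∞} = 0 := by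
      by_contra hne
      have hk : ∀ k : ℕ, (k : ℝ≥0∞) * volume {x | maxFn R F x = ∞} ≤ 5 ^ n * ∫⁻ y, F y := by
        intro k
        refine le_trans ?_ (weak_type R R0 hR hR0 F hF k)
        gcongr
        intro hx
        rw [hx]; exact ENNReal.natCast_lt_top k
      have hlt : (5 : ℝ≥0∞) ^ n * ∫⁻ y, F y < ∞ := ENNReal.mul_lt_top (by simp) hfin.lt_top
      obtain ⟨k, hk'⟩ := ENNReal.exists_nat_mul_gt hne hlt.ne
      exact absurd (hk k) (not_le.2 hk')
    rw [ae_iff]; simpa using h0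
  have e1 : ∫⁻ x, (maxFn R F x) ^ p = ∫⁻ x, ENNReal.ofReal ((maxFn R F x).toReal ^ p) := by
    apply lintegral_congr_ae
    filter_upwards [hae] with x hx
    rw [← ENNReal.ofReal_rpow_of_nonneg ENNReal.toReal_nonneg (by linarith), ENNReal.ofReal_toReal hx]
  rw [e1, lintegral_rpow_eq_lintegral_meas_lt_mul volume (ae_of_all _ fun _ => ENNReal.toReal_nonneg)
    hM.ennreal_toReal.aemeasurable (by linarith)]
  have e2 : ∀ t ∈ Ioi (0 : ℝ), volume {a | t < (maxFn R F a).toReal} * ENNReal.ofReal (t ^ (p - 1))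
      ≤ ∫⁻ y, 5 ^ n * (2 * ENNReal.ofReal (t ^ (p - 2))) * ({y | ENNReal.ofReal (t / 2) < F y}.indicator F y) := by
    intro t ht
    have ht' : 0 < t := ht
    have hw := weak_type R R0 hR hR0 ({y | ENNReal.ofReal (t / 2) < F y}.indicator F)
      (hF.indicator (measurableSet_lt measurable_const hF)) (ENNReal.ofReal (t / 2))
    rw [lintegral_const_mul _ (hF.indicator (measurableSet_lt measurable_const hF))]
    have hsub : {a | t < (maxFn R F a).toReal} ⊆
        {x | ENNReal.ofReal (t / 2) < maxFn R ({y | ENNReal.ofReal (t / 2) < F y}.indicator F) x} := by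
      intro x hx
      have hx' : ENNReal.ofReal t < maxFn R F x := (ENNReal.ofReal_lt_iff_lt_toReal ht'.le (by
        rintro h; simp [h] at hx; linarith)).2 hx
      have := hx'.trans_le (maxFn_split R F hF (ENNReal.ofReal (t / 2)) x)
      by_contra hcon
      have hcon' : maxFn R ({y | ENNReal.ofReal (t / 2) < F y}.indicator F) x ≤ ENNReal.ofReal (t / 2) :=
        not_lt.1 hcon
      have h3 := this.trans_le (add_le_add_left hcon' (ENNReal.ofReal (t / 2)))
      rw [← ENNReal.ofReal_add (by positivity) (by positivity)] at h3
      simp at h3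
    have e3 : ENNReal.ofReal (t ^ (p - 1)) = ENNReal.ofReal (t / 2) * (2 * ENNReal.ofReal (t ^ (p - 2))) := by
      rw [show (2 : ℝ≥0∞) = ENNReal.ofReal 2 by simp, ← ENNReal.ofReal_mul (by norm_num),
        ← ENNReal.ofReal_mul (by positivity)]
      congr 1
      rw [show p - 1 = (p - 2) + 1 by ring, Real.rpow_add_one ht'.ne']
      ring
    calc _ ≤ volume {x | ENNReal.ofReal (t / 2) < maxFn R ({y | ENNReal.ofReal (t / 2) < F y}.indicator F) x}
          * ENNReal.ofReal (t ^ (p - 1)) := by gcongr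
      _ = (ENNReal.ofReal (t / 2) * volume {x | ENNReal.ofReal (t / 2) < maxFn R ({y | ENNReal.ofReal (t / 2) < F y}.indicator F) x})
          * (2 * ENNReal.ofReal (t ^ (p - 2))) := by rw [e3]; ring
      _ ≤ (5 ^ n * ∫⁻ y, {y | ENNReal.ofReal (t / 2) < F y}.indicator F y) * (2 * ENNReal.ofReal (t ^ (p - 2))) := by gcongr
      _ = _ := by ring
  have e4 := setLIntegral_mono' (μ := volume) measurableSet_Ioi e2
  have e5 : ∫⁻ t in Ioi (0 : ℝ), ∫⁻ y, 5 ^ n * (2 * ENNReal.ofReal (t ^ (p - 2))) * ({y | ENNReal.ofReal (t / 2) < F y}.indicator F y)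
      = ∫⁻ y, ∫⁻ t in Ioi (0 : ℝ), 5 ^ n * (2 * ENNReal.ofReal (t ^ (p - 2))) * ({y | ENNReal.ofReal (t / 2) < F y}.indicator F y) := by
    apply lintegral_lintegral_swap
    apply Measurable.aemeasurable
    apply Measurable.mul
    · fun_prop
    · have : (fun q : ℝ × EuclideanSpace ℝ (Fin n) => {y | ENNReal.ofReal (q.1 / 2) < F y}.indicator F q.2)
        = {q : ℝ × EuclideanSpace ℝ (Fin n) | ENNReal.ofReal (q.1 / 2) < F q.2}.indicator (fun q => F q.2) := by
        ext q; simp [indicator]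
      show Measurable (fun q : ℝ × EuclideanSpace ℝ (Fin n) => {y | ENNReal.ofReal (q.1 / 2) < F y}.indicator F q.2)
      rw [this]
      refine Measurable.indicator (hF.comp measurable_snd) (measurableSet_lt (by fun_prop) (hF.comp measurable_snd))
  have e6 : ∀ y, ∫⁻ t in Ioi (0 : ℝ), 5 ^ n * (2 * ENNReal.ofReal (t ^ (p - 2))) * ({y | ENNReal.ofReal (t / 2) < F y}.indicator F y)
      ≤ ENNReal.ofReal (5 ^ n * 2 * 2 ^ (p - 1) / (p - 1)) * ENNReal.ofReal (g y) ^ p := by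
    intro y
    have hgy := hg0 y
    calc _ ≤ ∫⁻ t in Ioi (0 : ℝ), (Ioc 0 (2 * g y)).indicator (fun t => 5 ^ n * (2 * ENNReal.ofReal (t ^ (p - 2))) * F y) t := by
          apply setLIntegral_mono' measurableSet_Ioi
          intro t ht
          by_cases h : ENNReal.ofReal (t / 2) < F y
          · have h' : t / 2 < g y := by
              rw [hFdef] at h
              exact (ENNReal.ofReal_lt_ofReal_iff_of_nonneg (by have : 0 < t := ht; positivity)).1 h
            rw [indicator_of_mem (show t ∈ Ioc 0 (2 * g y) from ⟨ht, by linarith⟩)]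
            rw [indicator_of_mem (show y ∈ {y | ENNReal.ofReal (t / 2) < F y} from h)]
          · rw [indicator_of_notMem (show y ∉ {y | ENNReal.ofReal (t / 2) < F y} from h)]
            simp
      _ ≤ ∫⁻ t, (Ioc 0 (2 * g y)).indicator (fun t => 5 ^ n * (2 * ENNReal.ofReal (t ^ (p - 2))) * F y) t :=
          lintegral_mono' Measure.restrict_le_self le_rfl
      _ = ∫⁻ t in Ioc 0 (2 * g y), (5 ^ n * 2 * F y) * ENNReal.ofReal (t ^ (p - 2)) := by
          rw [lintegral_indicator measurableSet_Ioc]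
          congr 1; ext t; ring
      _ = (5 ^ n * 2 * F y) * ENNReal.ofReal ((2 * g y) ^ (p - 1) / (p - 1)) := by
          rw [lintegral_const_mul _ (by fun_prop), inner_int p hp _ (by positivity)]
      _ = _ := by
          rw [ENNReal.ofReal_rpow_of_nonneg hgy (by linarith), hFdef]
          rw [show (5 : ℝ≥0∞) = ENNReal.ofReal 5 by simp, show (2 : ℝ≥0∞) = ENNReal.ofReal 2 by simp,
            ← ENNReal.ofReal_pow (by norm_num), ← ENNReal.ofReal_mul (by positivity),
            ← ENNReal.ofReal_mul (by positivity), ← ENNReal.ofReal_mul (by positivity),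
            ← ENNReal.ofReal_mul (by have : 0 < p - 1 := by linarith
                                     positivity)]
          congr 1
          rw [Real.mul_rpow (by norm_num) hgy]
          have : g y ^ p = g y * g y ^ (p - 1) := by
            conv_lhs => rw [show p = (p - 1) + 1 by ring]
            rw [Real.rpow_add_one' hgy (by linarith)]; ring
          rw [this]; ring
  calc _ ≤ ENNReal.ofReal p * ∫⁻ y, ENNReal.ofReal (5 ^ n * 2 * 2 ^ (p - 1) / (p - 1)) * ENNReal.ofReal (g y) ^ p := by
        gcongr
        exact (e4.trans e5.le).trans (lintegral_mono e6)
    _ = _ := by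
        rw [lintegral_const_mul _ (by fun_prop), ← mul_assoc, ← ENNReal.ofReal_mul (by linarith)]
        congr 2; ring
end JSP


namespace JSP
open Set Filter Topology
open scoped ENNReal NNReal

lemma lint_affine {n : ℕ} (f : EuclideanSpace ℝ (Fin n) → ℝ≥0∞) (hf : Measurable f)
    (a : EuclideanSpace ℝ (Fin n)) (r : ℝ) (hr : 1 / 2 ≤ r) :
    ∫⁻ y, f (a + r • y) ≤ 2 ^ n * ∫⁻ y, f y := by
  have hr0 : 0 < r := by linarith
  have h1 : ∫⁻ y, f (a + r • y) = ∫⁻ z, f (a + z) ∂(Measure.map (r • ·) volume) := by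
    rw [lintegral_map (by fun_prop) (by fun_prop)]
  rw [h1, Measure.map_addHaar_smul volume hr0.ne', lintegral_smul_measure,
    lintegral_add_left_eq_self f a, smul_eq_mul]
  gcongr
  have h2 : (2 : ℝ≥0∞) ^ n = ENNReal.ofReal (2 ^ n) := by
    rw [ENNReal.ofReal_pow (by norm_num)]; simp
  rw [h2]
  apply ENNReal.ofReal_le_ofReal
  rw [abs_of_nonneg (by positivity), finrank_euclideanSpace_fin, ← inv_pow]
  gcongr
  rw [inv_le_comm₀ hr0 (by norm_num)]
  linarith

/-- length of the gradient, extended by zero -/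
noncomputable def grd {n : ℕ} (D : Set (EuclideanSpace ℝ (Fin n))) (u : EuclideanSpace ℝ (Fin n) → ℝ) :
    EuclideanSpace ℝ (Fin n) → ℝ := D.indicator (fun y => ‖fderiv ℝ u y‖)

lemma grd_meas {n : ℕ} (D : Set (EuclideanSpace ℝ (Fin n))) (hD : IsOpen D)
    (u : EuclideanSpace ℝ (Fin n) → ℝ) : Measurable (grd D u) :=
  (measurable_fderiv ℝ u).norm.indicator hD.measurableSet

lemma grd_nonneg {n : ℕ} (D : Set (EuclideanSpace ℝ (Fin n)))
    (u : EuclideanSpace ℝ (Fin n) → ℝ) (x) : 0 ≤ grd D u x :=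
  indicator_nonneg (fun _ _ => norm_nonneg _) _

lemma ftc {n : ℕ} (D : Set (EuclideanSpace ℝ (Fin n))) (hD : IsOpen D)
    (u : EuclideanSpace ℝ (Fin n) → ℝ) (hu : DifferentiableOn ℝ u D)
    (x y : EuclideanSpace ℝ (Fin n)) (hxy : ∀ t ∈ Icc (0 : ℝ) 1, x + t • (y - x) ∈ D) :
    ENNReal.ofReal |u y - u x| ≤ ENNReal.ofReal (dist x y) *
      ∫⁻ t in Icc (0 : ℝ) 1, ENNReal.ofReal (grd D u (x + t • (y - x))) := by
  rcases eq_or_ne x y with rfl | hne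
  · simp
  have hd : 0 < dist x y := dist_pos.2 hne
  by_cases hI : ∫⁻ t in Icc (0 : ℝ) 1, ENNReal.ofReal (grd D u (x + t • (y - x))) = ∞
  · rw [hI, ENNReal.mul_top (by simpa using hne)]
    exact le_top
  have hgm : Measurable (fun t : ℝ => grd D u (x + t • (y - x))) :=
    (grd_meas D hD u).comp (by fun_prop)
  have hgradA : IntegrableOn (fun t : ℝ => grd D u (x + t • (y - x))) (Icc 0 1) := by
    refine ⟨hgm.aestronglyMeasurable, ?_⟩
    rw [hasFiniteIntegral_iff_ofReal (ae_of_all _ fun t => grd_nonneg _ _ _)]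
    exact lt_top_iff_ne_top.2 hI
  have hderiv : ∀ t ∈ uIcc (0 : ℝ) 1, HasDerivAt (fun t : ℝ => u (x + t • (y - x)))
      (fderiv ℝ u (x + t • (y - x)) (y - x)) t := by
    intro t ht
    rw [uIcc_of_le zero_le_one] at ht
    have h1 := ((hu _ (hxy t ht)).differentiableAt (hD.mem_nhds (hxy t ht))).hasFDerivAt
    have h2 : HasDerivAt (fun t : ℝ => x + t • (y - x)) (y - x) t := by
      simpa using ((hasDerivAt_id t).smul_const (y - x)).const_add x
    exact h1.comp_hasDerivAt t h2
  have hbd : ∀ t ∈ Icc (0 : ℝ) 1, ‖fderiv ℝ u (x + t • (y - x)) (y - x)‖ ≤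
      dist x y * grd D u (x + t • (y - x)) := by
    intro t ht
    rw [grd, indicator_of_mem (hxy t ht), dist_comm, dist_eq_norm, mul_comm]
    exact ContinuousLinearMap.le_opNorm _ _
  have hgradB : IntegrableOn (fun t : ℝ => fderiv ℝ u (x + t • (y - x)) (y - x)) (Icc 0 1) := by
    refine Integrable.mono' (hgradA.const_mul (dist x y)) ?_ ?_
    · apply Measurable.aestronglyMeasurable
      exact (measurable_fderiv_apply_const ℝ u (y - x)).comp (by fun_prop : Measurable fun t : ℝ => x + t • (y - x))
    · filter_upwards [ae_restrict_mem measurableSet_Icc] with t ht using hbd t ht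
  have hF := intervalIntegral.integral_eq_sub_of_hasDerivAt hderiv
    ((intervalIntegrable_iff_integrableOn_Icc_of_le zero_le_one).2 hgradB)
  have e1 : |u y - u x| ≤ dist x y * ∫ t in Icc (0 : ℝ) 1, grd D u (x + t • (y - x)) := by
    have : u y - u x = ∫ t in Icc (0 : ℝ) 1, fderiv ℝ u (x + t • (y - x)) (y - x) := by
      rw [integral_Icc_eq_integral_Ioc, ← intervalIntegral.integral_of_le zero_le_one, hF]
      simp
    rw [this, ← integral_const_mul, ← Real.norm_eq_abs]
    refine norm_integral_le_of_norm_le (hgradA.const_mul _) ?_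
    filter_upwards [ae_restrict_mem measurableSet_Icc] with t ht using hbd t ht
  rw [← ofReal_integral_eq_lintegral_ofReal hgradA (ae_of_all _ fun t => grd_nonneg _ _ _),
    ← ENNReal.ofReal_mul hd.le]
  exact ENNReal.ofReal_le_ofReal e1

lemma double {n : ℕ} (D : Set (EuclideanSpace ℝ (Fin n))) (hD : IsOpen D)
    (u : EuclideanSpace ℝ (Fin n) → ℝ) (hu : DifferentiableOn ℝ u D)
    (c : EuclideanSpace ℝ (Fin n)) (R : ℝ) (hW : ball c R ⊆ D) :
    ∫⁻ x in ball c R, ∫⁻ y in ball c R, ENNReal.ofReal |u y - u x| ≤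
      ENNReal.ofReal (2 * R) * (2 ^ n * volume (ball c R) *
        ∫⁻ y in ball c R, ENNReal.ofReal (grd D u y)) := by
  set W := ball c R with hWdef
  have hWm : MeasurableSet W := measurableSet_ball
  have hconv : Convex ℝ W := convex_ball c R
  set F : EuclideanSpace ℝ (Fin n) → ℝ≥0∞ := fun y => ENNReal.ofReal (grd D u y) with hF
  have hFm : Measurable F := (grd_meas D hD u).ennreal_ofReal
  have hmem : ∀ x ∈ W, ∀ y ∈ W, ∀ t ∈ Icc (0 : ℝ) 1, x + t • (y - x) ∈ W := by
    intro x hx y hy t ht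
    exact hconv.add_smul_sub_mem hx hy ht
  have hFW : Measurable (W.indicator F) := hFm.indicator hWm
  have hone : ∀ t ∈ Icc (0 : ℝ) 1, 1 / 2 ≤ t → ∀ x ∈ W,
      ∫⁻ y in W, F (x + t • (y - x)) ≤ 2 ^ n * ∫⁻ y in W, F y := by
    intro t ht ht2 x hx
    calc ∫⁻ y in W, F (x + t • (y - x)) ≤ ∫⁻ y in W, W.indicator F ((x - t • x) + t • y) := by
          apply setLIntegral_mono' hWm
          intro y hy
          have h1 : (x - t • x) + t • y = x + t • (y - x) := by rw [smul_sub]; abel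
          rw [h1, indicator_of_mem (hmem x hx y hy t ht)]
      _ ≤ ∫⁻ y, W.indicator F ((x - t • x) + t • y) := lintegral_mono' Measure.restrict_le_self le_rfl
      _ ≤ _ := by
          refine (lint_affine _ hFW _ t ht2).trans ?_
          rw [lintegral_indicator hWm]
  have hjoint : Measurable (fun q : (EuclideanSpace ℝ (Fin n)) × (EuclideanSpace ℝ (Fin n)) × ℝ =>
      F (q.1 + q.2.2 • (q.2.1 - q.1))) := hFm.comp (by fun_prop)
  have hmid : ∀ t ∈ Icc (0 : ℝ) 1, ∫⁻ x in W, ∫⁻ y in W, F (x + t • (y - x)) ≤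
      2 ^ n * volume W * ∫⁻ y in W, F y := by
    intro t ht
    by_cases h : 1 / 2 ≤ t
    · calc _ ≤ ∫⁻ x in W, 2 ^ n * ∫⁻ y in W, F y := setLIntegral_mono' hWm (hone t ht h)
        _ = _ := by rw [setLIntegral_const]; ring
    · rw [lintegral_lintegral_swap (by
        apply Measurable.aemeasurable
        exact hFm.comp (by fun_prop : Measurable fun q : (EuclideanSpace ℝ (Fin n)) × (EuclideanSpace ℝ (Fin n)) => q.1 + t • (q.2 - q.1)))]
      calc _ ≤ ∫⁻ x in W, 2 ^ n * ∫⁻ y in W, F y := by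
            apply setLIntegral_mono' hWm
            intro y hy
            refine le_trans (le_of_eq ?_) (hone (1 - t) ⟨by linarith [ht.2], by linarith [ht.1]⟩ (by linarith) y hy)
            congr 1; ext x; congr 1
            rw [sub_smul, one_smul, smul_sub, smul_sub]; abel
        _ = _ := by rw [setLIntegral_const]; ring
  calc _ ≤ ∫⁻ x in W, ∫⁻ y in W, ENNReal.ofReal (2 * R) * ∫⁻ t in Icc (0 : ℝ) 1, F (x + t • (y - x)) := by
        apply setLIntegral_mono' hWm
        intro x hx
        apply setLIntegral_mono' hWm
        intro y hy
        refine (ftc D hD u hu x y fun t ht => hW (hmem x hx y hy t ht)).trans ?_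
        gcongr
        have h1 := mem_ball.1 hx
        have h2 := mem_ball.1 hy
        have := dist_triangle_right x y c
        linarith
    _ = ENNReal.ofReal (2 * R) * ∫⁻ x in W, ∫⁻ y in W, ∫⁻ t in Icc (0 : ℝ) 1, F (x + t • (y - x)) := by
        rw [← lintegral_const_mul _ (by
          apply Measurable.lintegral_prod_right' (f := fun q : EuclideanSpace ℝ (Fin n) × EuclideanSpace ℝ (Fin n) =>
            ∫⁻ t in Icc (0 : ℝ) 1, F (q.1 + t • (q.2 - q.1)))
          apply Measurable.lintegral_prod_right' (f := fun q : (EuclideanSpace ℝ (Fin n) × EuclideanSpace ℝ (Fin n)) × ℝ => F (q.1.1 + q.2 • (q.1.2 - q.1.1)))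
          exact hFm.comp (by fun_prop))]
        congr 1; ext x
        rw [← lintegral_const_mul _ (by
          apply Measurable.lintegral_prod_right' (f := fun q : (EuclideanSpace ℝ (Fin n)) × ℝ => F (x + q.2 • (q.1 - x)))
          exact hFm.comp (by fun_prop))]
    _ = ENNReal.ofReal (2 * R) * ∫⁻ t in Icc (0 : ℝ) 1, ∫⁻ x in W, ∫⁻ y in W, F (x + t • (y - x)) := by
        congr 1
        symm
        rw [lintegral_lintegral_swap (by
          apply Measurable.aemeasurable
          apply Measurable.lintegral_prod_right' (f := fun q : (ℝ × EuclideanSpace ℝ (Fin n)) × EuclideanSpace ℝ (Fin n) => F (q.1.2 + q.1.1 • (q.2 - q.1.2)))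
          exact hFm.comp (by fun_prop))]
        refine lintegral_congr fun x => ?_
        rw [lintegral_lintegral_swap (by
          apply Measurable.aemeasurable
          exact hFm.comp (by fun_prop : Measurable fun q : ℝ × (EuclideanSpace ℝ (Fin n)) => x + q.1 • (q.2 - x)))]
    _ ≤ ENNReal.ofReal (2 * R) * ∫⁻ t in Icc (0 : ℝ) 1, 2 ^ n * volume W * ∫⁻ y in W, F y := by
        gcongr 1
        exact setLIntegral_mono' measurableSet_Icc hmid
    _ = _ := by rw [setLIntegral_const]; simp

lemma u_int {n : ℕ} (D : Set (EuclideanSpace ℝ (Fin n))) (hD : IsOpen D)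
    (u : EuclideanSpace ℝ (Fin n) → ℝ) (hu : DifferentiableOn ℝ u D)
    (hfin : ∫⁻ y, ENNReal.ofReal (grd D u y) ≠ ∞)
    (c : EuclideanSpace ℝ (Fin n)) (R : ℝ) (hW : ball c R ⊆ D) : IntegrableOn u (ball c R) := by
  rcases le_or_gt R 0 with hR | hR
  · simp [ball_eq_empty.2 hR]
  have hum : AEStronglyMeasurable u (volume.restrict (ball c R)) :=
    (hu.continuousOn.mono hW).aestronglyMeasurable measurableSet_ball
  have h1 := double D hD u hu c R hW
  have h2 : ∫⁻ x in ball c R, ∫⁻ y in ball c R, ENNReal.ofReal |u y - u x| ≠ ∞ := by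
    refine (h1.trans_lt ?_).ne
    refine ENNReal.mul_lt_top ENNReal.ofReal_lt_top (ENNReal.mul_lt_top (ENNReal.mul_lt_top (by simp) measure_ball_lt_top) ?_)
    exact (lintegral_mono' Measure.restrict_le_self le_rfl).trans_lt hfin.lt_top
  have hexist : ∃ x, ∫⁻ y in ball c R, ENNReal.ofReal |u y - u x| ≠ ∞ := by
    by_contra hcon
    push Not at hcon
    apply h2
    simp_rw [hcon]
    rw [setLIntegral_const, ENNReal.top_mul (measure_ball_pos volume c hR).ne']
  obtain ⟨x, hx⟩ := hexist
  have h3 : IntegrableOn (fun y => u y - u x) (ball c R) := by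
    refine ⟨hum.sub aestronglyMeasurable_const, ?_⟩
    rw [hasFiniteIntegral_iff_norm]
    simpa using hx.lt_top
  have h4 := h3.add (integrableOn_const (C := u x) (μ := volume) (s := ball c R) measure_ball_lt_top.ne)
  refine h4.congr (ae_of_all _ fun y => by simp)

lemma poincare {n : ℕ} (D : Set (EuclideanSpace ℝ (Fin n))) (hD : IsOpen D)
    (u : EuclideanSpace ℝ (Fin n) → ℝ) (hu : DifferentiableOn ℝ u D)
    (hfin : ∫⁻ y, ENNReal.ofReal (grd D u y) ≠ ∞)
    (c : EuclideanSpace ℝ (Fin n)) (R : ℝ) (hW : ball c R ⊆ D)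
    (c1 c2 : EuclideanSpace ℝ (Fin n)) (r1 r2 : ℝ) (hr1 : 0 < r1) (hr2 : 0 < r2) (hR : 0 < R)
    (h1 : ball c1 r1 ⊆ ball c R) (h2 : ball c2 r2 ⊆ ball c R) :
    |(⨍ y in ball c1 r1, u y) - ⨍ y in ball c2 r2, u y| ≤
      2 ^ (n + 1) * R ^ (n + 1) / (r1 ^ n * r2 ^ n * volume.real (ball (0 : EuclideanSpace ℝ (Fin n)) 1)) *
        (∫⁻ y in ball c R, ENNReal.ofReal (grd D u y)).toReal := by
  set ω := volume.real (ball (0 : EuclideanSpace ℝ (Fin n)) 1) with hω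
  have hω0 : 0 < ω := by
    rw [hω, measureReal_def]
    exact ENNReal.toReal_pos (measure_ball_pos volume _ one_pos).ne' measure_ball_lt_top.ne
  have hv : ∀ (z : EuclideanSpace ℝ (Fin n)) (r : ℝ), 0 < r → volume.real (ball z r) = r ^ n * ω := by
    intro z r hr
    rw [measureReal_def, Measure.addHaar_ball_of_pos _ _ hr, finrank_euclideanSpace_fin,
      ENNReal.toReal_mul, ENNReal.toReal_ofReal (by positivity)]; rfl
  have hi1 := (u_int D hD u hu hfin c R hW).mono_set h1
  have hi2 := (u_int D hD u hu hfin c R hW).mono_set h2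
  have hΦ : (∫⁻ y in ball c R, ENNReal.ofReal (grd D u y)) ≠ ∞ :=
    ((lintegral_mono' Measure.restrict_le_self le_rfl).trans_lt hfin.lt_top).ne
  have hdouble : ENNReal.ofReal (∫ x in ball c1 r1, |∫ y in ball c2 r2, (u y - u x)|) ≤
      ∫⁻ x in ball c R, ∫⁻ y in ball c R, ENNReal.ofReal |u y - u x| := by
    have hle : ∀ x, ENNReal.ofReal |∫ y in ball c2 r2, (u y - u x)| ≤ ∫⁻ y in ball c R, ENNReal.ofReal |u y - u x| := by
      intro x
      have := enorm_integral_le_lintegral_enorm (μ := volume.restrict (ball c2 r2)) (fun y => u y - u x)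
      rw [← Real.enorm_eq_ofReal_abs]
      refine this.trans ?_
      simp_rw [Real.enorm_eq_ofReal_abs]
      exact lintegral_mono_set h2
    rw [ofReal_integral_eq_lintegral_ofReal]
    · calc _ ≤ ∫⁻ x in ball c1 r1, ∫⁻ y in ball c R, ENNReal.ofReal |u y - u x| := lintegral_mono hle
        _ ≤ _ := lintegral_mono_set h1
    · have hc : IntegrableOn (fun x => ∫ y in ball c2 r2, (u y - u x)) (ball c1 r1) := by
        have : ∀ x, ∫ y in ball c2 r2, (u y - u x) = (∫ y in ball c2 r2, u y) - volume.real (ball c2 r2) * u x := by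
          intro x
          rw [integral_sub hi2 (integrableOn_const measure_ball_lt_top.ne)]
          simp
        simp_rw [this]
        exact (integrableOn_const measure_ball_lt_top.ne).sub (hi1.const_mul _)
      exact hc.abs
    · exact ae_of_all _ fun _ => abs_nonneg _
  have hreal : ∫ x in ball c1 r1, |∫ y in ball c2 r2, (u y - u x)| ≤
      2 * R * (2 ^ n * (R ^ n * ω) * (∫⁻ y in ball c R, ENNReal.ofReal (grd D u y)).toReal) := by
    have h3 := hdouble.trans (double D hD u hu c R hW)
    have h4 := ENNReal.toReal_mono (by
      refine (ENNReal.mul_lt_top ENNReal.ofReal_lt_top (ENNReal.mul_lt_top (ENNReal.mul_lt_top (by simp) measure_ball_lt_top) hΦ.lt_top)).ne) h3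
    rw [ENNReal.toReal_ofReal (integral_nonneg fun _ => abs_nonneg _)] at h4
    refine h4.trans (le_of_eq ?_)
    rw [ENNReal.toReal_mul, ENNReal.toReal_mul, ENNReal.toReal_mul, ENNReal.toReal_ofReal (by positivity),
      ← measureReal_def, hv c R hR]
    simp
  have hkey : (r1 ^ n * ω) * (r2 ^ n * ω) * |(⨍ y in ball c1 r1, u y) - ⨍ y in ball c2 r2, u y| ≤
      ∫ x in ball c1 r1, |∫ y in ball c2 r2, (u y - u x)| := by
    have e : ∫ x in ball c1 r1, ∫ y in ball c2 r2, (u y - u x) =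
        (r1 ^ n * ω) * (r2 ^ n * ω) * ((⨍ y in ball c2 r2, u y) - ⨍ y in ball c1 r1, u y) := by
      have : ∀ x, ∫ y in ball c2 r2, (u y - u x) = (∫ y in ball c2 r2, u y) - volume.real (ball c2 r2) * u x := by
        intro x
        rw [integral_sub hi2 (integrableOn_const measure_ball_lt_top.ne)]
        simp
      simp_rw [this]
      rw [integral_sub (show Integrable (fun _ => ∫ y in ball c2 r2, u y) (volume.restrict (ball c1 r1)) from
          integrableOn_const measure_ball_lt_top.ne) (hi1.const_mul _), integral_const_mul,
        setAverage_eq, setAverage_eq, hv c1 r1 hr1, hv c2 r2 hr2]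
      simp only [integral_const, smul_eq_mul]
      rw [measureReal_restrict_apply MeasurableSet.univ, univ_inter, hv c1 r1 hr1]
      field_simp
    rw [abs_sub_comm, ← abs_of_pos (show 0 < (r1 ^ n * ω) * (r2 ^ n * ω) by positivity), ← abs_mul, ← e]
    exact abs_integral_le_integral_abs
  have := hkey.trans hreal
  rw [← le_div_iff₀' (by positivity)] at this
  refine this.trans (le_of_eq ?_)
  field_simp
  ring
end JSP


namespace JSP
open Set Filter Topology
open scoped ENNReal NNReal

lemma avg_cont {n : ℕ} (D : Set (EuclideanSpace ℝ (Fin n))) 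
    (u : EuclideanSpace ℝ (Fin n) → ℝ) (hu : ContinuousOn u D)
    (γ : ℝ → EuclideanSpace ℝ (Fin n)) (t1 t2 : ℝ) (hγ : ContinuousOn γ (Icc t1 t2))
    (h : ℝ) (hsub : ∀ t ∈ Icc t1 t2, closedBall (γ t) h ⊆ D) :
    ContinuousOn (fun t => ⨍ y in ball (γ t) h, u y) (Icc t1 t2) := by
  have e : ∀ t, (⨍ y in ball (γ t) h, u y) =
      (volume.real (ball (0 : EuclideanSpace ℝ (Fin n)) h))⁻¹ * ∫ z in ball (0 : EuclideanSpace ℝ (Fin n)) h, u (γ t + z) := by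
    intro t
    rw [setAverage_eq, Measure.addHaar_real_ball_center, smul_eq_mul]
    congr 1
    have := (measurePreserving_add_left (volume : Measure (EuclideanSpace ℝ (Fin n))) (γ t)).setIntegral_preimage_emb
      (measurableEmbedding_addLeft (γ t)) u (ball (γ t) h)
    rw [← this, preimage_add_ball, sub_self]
  simp_rw [e]
  refine ContinuousOn.mul continuousOn_const ?_
  have hK : IsCompact ((fun q : ℝ × EuclideanSpace ℝ (Fin n) => γ q.1 + q.2) '' (Icc t1 t2 ×ˢ closedBall 0 h)) := by
    apply (isCompact_Icc.prod (isCompact_closedBall 0 h)).image_of_continuousOn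
    exact (hγ.comp continuousOn_fst (fun q hq => hq.1)).add continuousOn_snd
  have hKD : (fun q : ℝ × EuclideanSpace ℝ (Fin n) => γ q.1 + q.2) '' (Icc t1 t2 ×ˢ closedBall 0 h) ⊆ D := by
    rintro _ ⟨⟨t, z⟩, ⟨ht, hz⟩, rfl⟩
    apply hsub t ht
    simpa [mem_closedBall, dist_eq_norm] using hz
  obtain ⟨B, hB⟩ := hK.exists_bound_of_continuousOn (hu.mono hKD)
  intro t0 ht0
  have hcts : ∀ t ∈ Icc t1 t2, ContinuousOn (fun z => u (γ t + z)) (closedBall 0 h) := by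
    intro t ht
    refine hu.comp (by fun_prop) ?_
    intro z hz
    exact hKD ⟨(t, z), ⟨ht, hz⟩, rfl⟩
  refine continuousWithinAt_of_dominated (bound := fun _ => B) ?_ ?_ ?_ ?_
  · filter_upwards [self_mem_nhdsWithin] with t ht
    exact ((hcts t ht).mono ball_subset_closedBall).aestronglyMeasurable measurableSet_ball
  · filter_upwards [self_mem_nhdsWithin] with t ht
    filter_upwards [ae_restrict_mem measurableSet_ball] with z hz
    exact hB _ ⟨(t, z), ⟨ht, ball_subset_closedBall hz⟩, rfl⟩
  · exact integrableOn_const measure_ball_lt_top.ne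
  · filter_upwards [ae_restrict_mem measurableSet_ball] with z hz
    have h1 : ContinuousOn (fun t => u (γ t + z)) (Icc t1 t2) := by
      refine hu.comp (hγ.add continuousOn_const) ?_
      intro t ht
      exact hKD ⟨(t, z), ⟨ht, ball_subset_closedBall hz⟩, rfl⟩
    exact h1 t0 ht0

lemma exists_net {n : ℕ} (K : Set (EuclideanSpace ℝ (Fin n))) (hK : IsCompact K) (h : ℝ) (hh : 0 < h) :
    ∃ V : Finset (EuclideanSpace ℝ (Fin n)), (∀ v ∈ V, v ∈ K) ∧
      (∀ v ∈ V, ∀ w ∈ V, v ≠ w → h ≤ dist v w) ∧ ∀ x ∈ K, ∃ v ∈ V, dist x v ≤ h := by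
  obtain ⟨e, he⟩ : ∃ e : ℝ≥0, (e : ℝ) = h := ⟨⟨h, hh.le⟩, rfl⟩
  have h1 : packingNumber e K ≠ ⊤ := by
    have h2 := packingNumber_two_mul_le_externalCoveringNumber (e / 2) K
    rw [mul_div_cancel₀ _ (two_ne_zero)] at h2
    refine ne_top_of_le_ne_top ?_ h2
    obtain ⟨t, ht, hfin, hcov⟩ := hK.finite_cover_balls (show 0 < h / 2 by positivity)
    have hc : IsCover (e / 2) K t := by
      intro x hx
      obtain ⟨y, hy, hxy⟩ := mem_iUnion₂.1 (hcov hx)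
      refine ⟨y, hy, ?_⟩
      have h3 : nndist x y ≤ e / 2 := by
        rw [← NNReal.coe_le_coe]
        simpa [he] using (mem_ball.1 hxy).le
      change edist x y ≤ _
      rw [edist_nndist]
      exact_mod_cast h3
    refine ne_top_of_le_ne_top (b := t.encard) (by simpa using hfin) ?_
    exact hc.externalCoveringNumber_le_encard
  have hfin : (maximalSeparatedSet e K).Finite := by
    rw [← encard_ne_top_iff, encard_maximalSeparatedSet h1]; exact h1
  refine ⟨hfin.toFinset, ?_, ?_, ?_⟩
  · intro v hv
    exact maximalSeparatedSet_subset (hfin.mem_toFinset.1 hv)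
  · intro v hv w hw hvw
    have h3 := isSeparated_maximalSeparatedSet (ε := e) (A := K) (hfin.mem_toFinset.1 hv) (hfin.mem_toFinset.1 hw) hvw
    replace h3 : (e : ℝ≥0∞) < edist v w := h3
    rw [edist_nndist] at h3
    have h4 : e < nndist v w := by exact_mod_cast h3
    have h5 : (e : ℝ) < (nndist v w : ℝ) := by exact_mod_cast h4
    simpa [he] using h5.le
  · intro x hx
    obtain ⟨v, hv, hxv⟩ := isCover_maximalSeparatedSet h1 hx
    refine ⟨v, hfin.mem_toFinset.2 hv, ?_⟩
    change edist x v ≤ _ at hxv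
    rw [edist_nndist] at hxv
    have h4 : nndist x v ≤ e := by exact_mod_cast hxv
    have h5 : (nndist x v : ℝ) ≤ (e : ℝ) := by exact_mod_cast h4
    simpa [he] using h5

lemma overlap {n : ℕ} (V : Finset (EuclideanSpace ℝ (Fin n))) (h : ℝ) (hh : 0 < h)
    (hsep : ∀ v ∈ V, ∀ w ∈ V, v ≠ w → h ≤ dist v w)
    (F : EuclideanSpace ℝ (Fin n) → ℝ≥0∞) (hF : Measurable F) (S : Set (EuclideanSpace ℝ (Fin n)))
    (hS : MeasurableSet S) (hsub : ∀ v ∈ V, ball v (2 * h) ⊆ S) :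
    ∑ v ∈ V, ∫⁻ y in ball v (2 * h), F y ≤ 5 ^ n * ∫⁻ y in S, F y := by
  classical
  have e1 : ∀ v ∈ V, ∫⁻ y in ball v (2 * h), F y = ∫⁻ y, (ball v (2 * h)).indicator F y := by
    intro v _
    rw [lintegral_indicator measurableSet_ball]
  rw [Finset.sum_congr rfl e1, ← lintegral_finsetSum _ (fun v _ => hF.indicator measurableSet_ball),
    ← lintegral_const_mul _ hF, ← lintegral_indicator hS]
  apply lintegral_mono
  intro y
  by_cases hy : y ∈ S
  · rw [indicator_of_mem hy]
    beta_reduce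
    have e2 : ∀ v ∈ V, (ball v (2 * h)).indicator F y = if y ∈ ball v (2 * h) then F y else 0 := by
      intro v _; simp [indicator]
    rw [Finset.sum_congr rfl e2, ← Finset.sum_filter, Finset.sum_const, nsmul_eq_mul]
    gcongr
    have hcard : (V.filter (fun v => y ∈ ball v (2 * h))).card ≤ 5 ^ n := by
      set V' := V.filter (fun v => y ∈ ball v (2 * h)) with hV'
      have hinj : Function.Injective (fun v : EuclideanSpace ℝ (Fin n) => h⁻¹ • (v - y)) := by
        intro v w hvw
        have := smul_right_injective _ (inv_ne_zero hh.ne') hvw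
        simpa using this
      rw [← Finset.card_image_of_injective V' hinj]
      have := Besicovitch.card_le_of_separated (V'.image (fun v => h⁻¹ • (v - y))) ?_ ?_
      · simpa using this
      · intro c hc
        obtain ⟨v, hv, rfl⟩ := Finset.mem_image.1 hc
        have h1 : dist y v < 2 * h := (Finset.mem_filter.1 hv).2
        rw [norm_smul, norm_inv, Real.norm_of_nonneg hh.le, ← dist_eq_norm, dist_comm, inv_mul_le_iff₀ hh]
        linarith
      · intro c hc d hd hcd
        obtain ⟨v, hv, rfl⟩ := Finset.mem_image.1 hc
        obtain ⟨w, hw, rfl⟩ := Finset.mem_image.1 hd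
        have hvw : v ≠ w := fun h => hcd (by rw [h])
        have h1 := hsep v (Finset.mem_filter.1 hv).1 w (Finset.mem_filter.1 hw).1 hvw
        rw [← smul_sub, sub_sub_sub_cancel_right, norm_smul, norm_inv, Real.norm_of_nonneg hh.le, ← dist_eq_norm,
          le_inv_mul_iff₀ hh]
        linarith
    exact_mod_cast hcard
  · rw [indicator_of_notMem hy]
    simp only [nonpos_iff_eq_zero]
    apply Finset.sum_eq_zero
    intro v hv
    exact indicator_of_notMem (fun h' => hy (hsub v hv h')) _

lemma scale {n : ℕ} (D : Set (EuclideanSpace ℝ (Fin n))) (hD : IsOpen D)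
    (u : EuclideanSpace ℝ (Fin n) → ℝ) (hu : DifferentiableOn ℝ u D)
    (hfin : ∫⁻ y, ENNReal.ofReal (grd D u y) ≠ ∞)
    (γ : ℝ → EuclideanSpace ℝ (Fin n)) (t1 t2 : ℝ) (ht : t1 ≤ t2) (hγ : ContinuousOn γ (Icc t1 t2))
    (h : ℝ) (hh : 0 < h) (hsub : ∀ t ∈ Icc t1 t2, ball (γ t) (2 * h) ⊆ D)
    (S : Set (EuclideanSpace ℝ (Fin n))) (hS : MeasurableSet S)
    (hsub2 : ∀ t ∈ Icc t1 t2, ball (γ t) (2 * h) ⊆ S) :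
    |(⨍ y in ball (γ t1) h, u y) - ⨍ y in ball (γ t2) h, u y| ≤
      2 * 5 ^ n * (2 ^ (n + 1) * (2 * h) ^ (n + 1) /
        (h ^ n * h ^ n * volume.real (ball (0 : EuclideanSpace ℝ (Fin n)) 1))) *
        (∫⁻ y in S, ENNReal.ofReal (grd D u y)).toReal := by
  set A : EuclideanSpace ℝ (Fin n) → ℝ := fun c => ⨍ y in ball c h, u y with hA
  set c0 : ℝ := (2 ^ (n + 1) * (2 * h) ^ (n + 1) /
        (h ^ n * h ^ n * volume.real (ball (0 : EuclideanSpace ℝ (Fin n)) 1))) with hc0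
  have hc0' : 0 ≤ c0 := by rw [hc0]; positivity
  have hFm : Measurable (fun y => ENNReal.ofReal (grd D u y)) := (grd_meas D hD u).ennreal_ofReal
  have hfinS : ∀ S : Set (EuclideanSpace ℝ (Fin n)), ∫⁻ y in S, ENNReal.ofReal (grd D u y) ≠ ∞ := fun S =>
    ((lintegral_mono' Measure.restrict_le_self le_rfl).trans_lt hfin.lt_top).ne
  have hcont : ContinuousOn (fun t => A (γ t)) (Icc t1 t2) :=
    avg_cont D u hu.continuousOn γ t1 t2 hγ h fun t ht =>
      (closedBall_subset_ball (by linarith)).trans (hsub t ht)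
  obtain ⟨V, hVK, hsep, hcov⟩ := exists_net (γ '' Icc t1 t2) (isCompact_Icc.image_of_continuousOn hγ) h hh
  have hV : ∀ v ∈ V, ∃ t ∈ Icc t1 t2, γ t = v := fun v hv => hVK v hv
  set g : EuclideanSpace ℝ (Fin n) → ℝ := fun v => c0 * (∫⁻ y in ball v (2 * h), ENNReal.ofReal (grd D u y)).toReal with hg
  have hg0 : ∀ v, 0 ≤ g v := fun v => by rw [hg]; positivity
  have hcover : uIcc (A (γ t1)) (A (γ t2)) ⊆ ⋃ v ∈ V, Icc (A v - g v) (A v + g v) := by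
    have hcont' : ContinuousOn (fun t => A (γ t)) (uIcc t1 t2) := by rwa [uIcc_of_le ht]
    refine (intermediate_value_uIcc hcont').trans ?_
    rw [uIcc_of_le ht]
    rintro _ ⟨t, htt, rfl⟩
    obtain ⟨v, hv, hd⟩ := hcov (γ t) ⟨t, htt, rfl⟩
    obtain ⟨t', ht', hvt⟩ := hV v hv
    have hb := poincare D hD u hu hfin v (2 * h) (hvt ▸ hsub t' ht') (γ t) v h h hh hh (by linarith)
      (ball_subset_ball' (by linarith)) (ball_subset_ball (by linarith))
    refine mem_biUnion hv ?_
    have hb' : |A (γ t) - A v| ≤ g v := hb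
    rw [abs_le] at hb'
    constructor <;> linarith [hb'.1, hb'.2]
  have hvol := (measure_mono hcover).trans (measure_biUnion_finset_le (μ := volume) V _)
  rw [Real.volume_interval] at hvol
  have hvol2 : |A (γ t2) - A (γ t1)| ≤ ∑ v ∈ V, 2 * g v := by
    rw [← ENNReal.ofReal_le_ofReal_iff (Finset.sum_nonneg fun v _ => by have := hg0 v; positivity),
      ENNReal.ofReal_sum_of_nonneg (fun v _ => by have := hg0 v; positivity)]
    refine hvol.trans (le_of_eq ?_)
    refine Finset.sum_congr rfl fun v _ => ?_
    rw [Real.volume_Icc]; congr 1; ring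
  have hov := overlap V h hh hsep _ hFm S hS (fun v hv => by
    obtain ⟨t', ht', hvt⟩ := hV v hv
    exact hvt ▸ hsub2 t' ht')
  have hov2 := ENNReal.toReal_mono (ENNReal.mul_lt_top (by simp) (hfinS S).lt_top).ne hov
  rw [ENNReal.toReal_sum (fun v _ => hfinS _), ENNReal.toReal_mul] at hov2
  rw [abs_sub_comm]
  refine hvol2.trans ?_
  calc ∑ v ∈ V, 2 * g v = 2 * c0 * ∑ v ∈ V, (∫⁻ y in ball v (2 * h), ENNReal.ofReal (grd D u y)).toReal := by
        rw [Finset.mul_sum]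
        refine Finset.sum_congr rfl fun v _ => ?_
        rw [hg]; ring
    _ ≤ 2 * c0 * ((5 ^ n : ℝ≥0∞).toReal * (∫⁻ y in S, ENNReal.ofReal (grd D u y)).toReal) := by gcongr
    _ = _ := by simp; ring
end JSP


namespace JSP
open Set Filter Topology
open scoped ENNReal NNReal

lemma avg_close {n : ℕ} (u : EuclideanSpace ℝ (Fin n) → ℝ) (c : EuclideanSpace ℝ (Fin n)) (r : ℝ) (hr : 0 < r)
    (v ε : ℝ) (hi : IntegrableOn u (ball c r)) (h : ∀ y ∈ ball c r, |u y - v| ≤ ε) :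
    |(⨍ y in ball c r, u y) - v| ≤ ε := by
  have := (convex_closedBall v ε).set_average_mem (μ := volume) (t := ball c r) (f := u) isClosed_closedBall
    (measure_ball_pos volume c hr).ne' measure_ball_lt_top.ne (by
      filter_upwards [ae_restrict_mem measurableSet_ball] with y hy
      simpa [Real.dist_eq] using h y hy) hi
  simpa [Real.dist_eq] using this

lemma rad_bound (n : ℕ) (hn : 2 ≤ n) (τ s K : ℝ) (hτ : 0 < τ) (hs1 : 1 ≤ s) (hs2 : s ≤ 2) (hK : 1 ≤ K) :
    ((τ / 2) ^ s / (4 * K)) / ((τ / 2) ^ s / (4 * K)) ^ n ≤ (16 * K) ^ n * τ ^ (-(s * ((n : ℝ) - 1))) := by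
  have hq : 0 < τ ^ s := Real.rpow_pos_of_pos hτ s
  have h1 : τ ^ (-(s * ((n : ℝ) - 1))) = τ ^ s / (τ ^ s) ^ n := by
    rw [← Real.rpow_mul_natCast hτ.le, ← Real.rpow_sub hτ]
    congr 1; ring
  have hm1 : (1 : ℝ) ≤ 2 ^ s := Real.one_le_rpow (by norm_num) (by linarith)
  have hm2 : (2 : ℝ) ^ s ≤ 4 := by
    calc (2 : ℝ) ^ s ≤ 2 ^ (2 : ℝ) := Real.rpow_le_rpow_of_exponent_le (by norm_num) hs2
      _ = 4 := by norm_num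
  rw [h1, Real.div_rpow hτ.le (by norm_num), show τ ^ s / 2 ^ s / (4 * K) = τ ^ s / (2 ^ s * (4 * K)) from div_div _ _ _]
  set q := τ ^ s
  set m := (2 : ℝ) ^ s * (4 * K) with hm
  have hm0 : 1 ≤ m := by rw [hm]; nlinarith
  have hm3 : m ≤ 16 * K := by rw [hm]; nlinarith
  calc q / m / (q / m) ^ n = (m ^ n / m) * (q / q ^ n) := by
        rw [div_pow]; field_simp
    _ ≤ (16 * K) ^ n * (q / q ^ n) := by
        gcongr
        calc m ^ n / m ≤ m ^ n := div_le_self (by positivity) hm0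
          _ ≤ _ := by gcongr

/-- constant in the chain estimate -/
noncomputable def chC (n : ℕ) (T K d0 : ℝ) : ℝ :=
  (2 * 5 ^ n * 4 ^ (n + 1) + 2 ^ (n + 1) * 4 ^ n) /
    volume.real (ball (0 : EuclideanSpace ℝ (Fin n)) 1) * (16 * K) ^ n +
  2 ^ (n + 1) * d0 * (4 * K) ^ n / volume.real (ball (0 : EuclideanSpace ℝ (Fin n)) 1) * T ^ (2 * n)

lemma chain {n : ℕ} (hn : 2 ≤ n) (D : Set (EuclideanSpace ℝ (Fin n))) (hD : IsOpen D)
    (u : EuclideanSpace ℝ (Fin n) → ℝ) (hu : DifferentiableOn ℝ u D)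
    (hfin : ∫⁻ y, ENNReal.ofReal (grd D u y) ≠ ∞)
    (T K d0 s : ℝ) (hT : 2 ≤ T) (hK : T ^ 2 ≤ K) (hd0 : 0 < d0) (hKd : T ^ 2 ≤ K * d0) (hdT : d0 ≤ T)
    (hs1 : 1 ≤ s) (hs2 : s ≤ 2)
    (x x₀ : EuclideanSpace ℝ (Fin n)) (hx : x ∈ D) (hB : ball x₀ d0 ⊆ D)
    (γ : ℝ → EuclideanSpace ℝ (Fin n)) (hγ : ContinuousOn γ (Icc 0 T)) (hγT : γ T = x₀)
    (hdist : ∀ t ∈ Icc 0 T, dist (γ t) x ≤ t)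
    (hball : ∀ t ∈ Ioc 0 T, ball (γ t) (t ^ s / K) ⊆ D) (S : ℝ)
    (hS : ∀ J, ∑ j ∈ Finset.range J, (T / 2 ^ j) ^ (-(s * ((n : ℝ) - 1))) *
      (∫⁻ y in closedBall x (2 * (T / 2 ^ j)), ENNReal.ofReal (grd D u y)).toReal ≤ S) :
    |u x - ⨍ y in ball x₀ d0, u y| ≤ chC n T K d0 * S := by
  have hω0 : 0 < volume.real (ball (0 : EuclideanSpace ℝ (Fin n)) 1) := by
    rw [measureReal_def]
    exact ENNReal.toReal_pos (measure_ball_pos volume _ one_pos).ne' measure_ball_lt_top.ne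
  unfold chC
  set ω := volume.real (ball (0 : EuclideanSpace ℝ (Fin n)) 1) with hω
  have hK4 : 4 ≤ K := by nlinarith
  have hK0 : 0 < K := by linarith
  set τ : ℕ → ℝ := fun j => T / 2 ^ j with hτ
  have hτ0 : ∀ j, 0 < τ j := fun j => by rw [hτ]; positivity
  have hτT : ∀ j, τ j ≤ T := fun j => div_le_self (by linarith) (one_le_pow₀ (by norm_num))
  have hτs : ∀ j, τ (j + 1) = τ j / 2 := fun j => by simp only [hτ]; rw [pow_succ]; field_simp
  set h : ℕ → ℝ := fun j => (τ j / 2) ^ s / (4 * K) with hh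
  have hpow0 : ∀ j, 0 < (τ j / 2) ^ s := fun j => Real.rpow_pos_of_pos (by have := hτ0 j; positivity) _
  have hh0 : ∀ j, 0 < h j := fun j => by have := hpow0 j; rw [hh]; positivity
  have hpow : ∀ t, 0 < t → t ≤ T → t ^ s ≤ t * T := by
    intro t ht htT
    have : t ^ s = t * t ^ (s - 1) := by
      rw [← Real.rpow_one_add' ht.le (by linarith)]; congr 1; ring
    rw [this]
    gcongr
    calc t ^ (s - 1) ≤ T ^ (s - 1) := Real.rpow_le_rpow ht.le htT (by linarith)
      _ ≤ T ^ (1 : ℝ) := Real.rpow_le_rpow_of_exponent_le (by linarith) (by linarith)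
      _ = T := Real.rpow_one T
  have hhτ : ∀ j, 2 * h j ≤ τ j := by
    intro j
    have h1 := hpow (τ j / 2) (by have := hτ0 j; positivity) (by linarith [hτ0 j, hτT j])
    have h2 : 2 * h j = (τ j / 2) ^ s / (2 * K) := by rw [hh]; field_simp; ring
    rw [h2, div_le_iff₀ (by positivity)]
    have := hτ0 j
    nlinarith [mul_pos this hK0]
  set A : ℕ → ℝ := fun j => ⨍ y in ball (γ (τ j)) (h j), u y with hA
  set Φ : ℕ → ℝ := fun j => (∫⁻ y in closedBall x (2 * (T / 2 ^ j)), ENNReal.ofReal (grd D u y)).toReal with hΦ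
  have hΦ0 : ∀ j, 0 ≤ Φ j := fun j => ENNReal.toReal_nonneg
  have hfinS : ∀ S : Set (EuclideanSpace ℝ (Fin n)), ∫⁻ y in S, ENNReal.ofReal (grd D u y) ≠ ∞ := fun S =>
    ((lintegral_mono' Measure.restrict_le_self le_rfl).trans_lt hfin.lt_top).ne
  set C1 : ℝ := (2 * 5 ^ n * 4 ^ (n + 1) + 2 ^ (n + 1) * 4 ^ n) / ω * (16 * K) ^ n with hC1
  set C2 : ℝ := 2 ^ (n + 1) * d0 * (4 * K) ^ n / ω * T ^ (2 * n) with hC2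
  have hC10 : 0 ≤ C1 := by rw [hC1]; positivity
  have hC20 : 0 ≤ C2 := by rw [hC2]; positivity
  set a : ℕ → ℝ := fun j => (T / 2 ^ j) ^ (-(s * ((n : ℝ) - 1))) * Φ j with ha
  have hS' : ∀ J, ∑ j ∈ Finset.range J, a j ≤ S := hS
  -- subsets
  have hsubD : ∀ j, ∀ t ∈ Icc (τ (j + 1)) (τ j), ball (γ t) (2 * h j) ⊆ D := by
    intro j t ht
    refine (ball_subset_ball ?_).trans (hball t ⟨(hτ0 _).trans_le ht.1, ht.2.trans (hτT j)⟩)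
    have h1 : (τ j / 2) ^ s ≤ t ^ s := by
      rw [← hτs]
      exact Real.rpow_le_rpow (hτ0 _).le ht.1 (by linarith)
    have h2 : 2 * h j = (τ j / 2) ^ s / (2 * K) := by rw [hh]; field_simp; ring
    rw [h2]
    have h3 := hpow0 j
    exact div_le_div₀ (h3.le.trans h1) h1 hK0 (by linarith)
  have hsubS : ∀ j, ∀ t ∈ Icc (τ (j + 1)) (τ j), ball (γ t) (2 * h j) ⊆ closedBall x (2 * (T / 2 ^ j)) := by
    intro j t ht
    have h1 := hdist t ⟨((hτ0 _).trans_le ht.1).le, ht.2.trans (hτT j)⟩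
    refine ball_subset_closedBall.trans (closedBall_subset_closedBall' ?_)
    have h2 := hhτ j
    have h3 : T / 2 ^ j = τ j := rfl
    rw [h3]
    linarith [ht.2]
  have hmem : ∀ j, τ (j + 1) ∈ Icc (τ (j + 1)) (τ j) := fun j =>
    ⟨le_rfl, by rw [hτs]; linarith [hτ0 j]⟩
  have hstep : ∀ j, |A j - A (j + 1)| ≤ C1 * a j := by
    intro j
    have hj := hh0 j
    have hj1 := hh0 (j + 1)
    have hR := rad_bound n hn (τ j) s K (hτ0 j) hs1 hs2 (by linarith)
    have b1 := scale D hD u hu hfin γ (τ (j + 1)) (τ j) (hmem j).2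
      (hγ.mono (Icc_subset_Icc (hτ0 _).le (hτT j))) (h j) hj (hsubD j) _ measurableSet_closedBall (hsubS j)
    have hle : h (j + 1) ≤ h j := by
      simp only [hh]
      rw [hτs]
      have := hτ0 j
      refine div_le_div_of_nonneg_right ?_ (by positivity)
      exact Real.rpow_le_rpow (by positivity) (by linarith) (by linarith)
    have hge : h j / 4 ≤ h (j + 1) := by
      simp only [hh]
      rw [hτs, Real.div_rpow (by have := hτ0 j; positivity : 0 ≤ τ j / 2) (by norm_num : (0 : ℝ) ≤ 2)]
      have hm2 : (2 : ℝ) ^ s ≤ 4 := by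
        calc (2 : ℝ) ^ s ≤ 2 ^ (2 : ℝ) := Real.rpow_le_rpow_of_exponent_le (by norm_num) hs2
          _ = 4 := by norm_num
      have hm0 : 0 < (2 : ℝ) ^ s := by positivity
      have := hpow0 j
      rw [div_right_comm ((τ j / 2) ^ s) ((2 : ℝ) ^ s) (4 * K)]
      exact div_le_div_of_nonneg_left (by positivity) hm0 hm2
    have b2 := poincare D hD u hu hfin (γ (τ (j + 1))) (h j)
      ((ball_subset_ball (by linarith)).trans (hsubD j _ (hmem j)))
      (γ (τ (j + 1))) (γ (τ (j + 1))) (h j) (h (j + 1)) hj hj1 hj le_rfl (ball_subset_ball hle)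
    have hΦle : (∫⁻ y in ball (γ (τ (j + 1))) (h j), ENNReal.ofReal (grd D u y)).toReal ≤ Φ j := by
      apply ENNReal.toReal_mono (hfinS _)
      exact lintegral_mono_set ((ball_subset_ball (by linarith)).trans (hsubS j _ (hmem j)))
    have b2' : |(⨍ y in ball (γ (τ (j + 1))) (h j), u y) - A (j + 1)| ≤
        2 ^ (n + 1) * 4 ^ n / ω * (h j / (h j) ^ n) * Φ j := by
      refine b2.trans ?_
      refine mul_le_mul ?_ hΦle ENNReal.toReal_nonneg (by positivity)
      calc 2 ^ (n + 1) * h j ^ (n + 1) / (h j ^ n * h (j + 1) ^ n * ω)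
          ≤ 2 ^ (n + 1) * h j ^ (n + 1) / (h j ^ n * (h j / 4) ^ n * ω) := by gcongr
        _ = _ := by
            have hj' := hj
            generalize h j = z at hj'
            rw [div_pow, pow_succ z n]; field_simp
    have b1' : |(⨍ y in ball (γ (τ (j + 1))) (h j), u y) - A j| ≤
        2 * 5 ^ n * 4 ^ (n + 1) / ω * (h j / (h j) ^ n) * Φ j := by
      refine b1.trans (le_of_eq ?_)
      congr 1
      rw [mul_pow]
      have : (4 : ℝ) ^ (n + 1) = 2 ^ (n + 1) * 2 ^ (n + 1) := by rw [← mul_pow]; norm_num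
      rw [this, ← hω, pow_succ (h j) n]
      field_simp
    have tri : |A j - A (j + 1)| ≤ |(⨍ y in ball (γ (τ (j + 1))) (h j), u y) - A j| +
        |(⨍ y in ball (γ (τ (j + 1))) (h j), u y) - A (j + 1)| := by
      rw [abs_sub_comm (⨍ y in ball (γ (τ (j + 1))) (h j), u y) (A j)]
      exact abs_sub_le _ _ _
    calc |A j - A (j + 1)| ≤ (2 * 5 ^ n * 4 ^ (n + 1) + 2 ^ (n + 1) * 4 ^ n) / ω * (h j / (h j) ^ n) * Φ j := by
          refine (tri.trans (add_le_add b1' b2')).trans (le_of_eq ?_)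
          ring
      _ ≤ (2 * 5 ^ n * 4 ^ (n + 1) + 2 ^ (n + 1) * 4 ^ n) / ω * ((16 * K) ^ n * (τ j) ^ (-(s * ((n : ℝ) - 1)))) * Φ j := by
          have := hΦ0 j
          gcongr
      _ = C1 * a j := by
          simp only [hC1, ha, hτ]; ring
  have hfinal : |A 0 - ⨍ y in ball x₀ d0, u y| ≤ C2 * a 0 := by
    have hτ00 : τ 0 = T := by simp [hτ]
    have hA0 : A 0 = ⨍ y in ball x₀ (h 0), u y := by simp only [hA, hτ00, hγT]
    have hh00 : h 0 ≤ d0 := by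
      simp only [hh, hτ00]
      rw [div_le_iff₀ (by positivity)]
      have h1 := hpow (T / 2) (by linarith) (by linarith)
      nlinarith
    have hh01 : 1 / (4 * K) ≤ h 0 := by
      simp only [hh, hτ00]
      gcongr
      exact Real.one_le_rpow (by linarith) (by linarith)
    have b := poincare D hD u hu hfin x₀ d0 hB x₀ x₀ (h 0) d0 (hh0 0) hd0 hd0 (ball_subset_ball hh00) le_rfl
    have hxx : dist x₀ x ≤ T := by
      have := hdist T ⟨by linarith, le_rfl⟩
      rwa [hγT] at this
    have hΦle : (∫⁻ y in ball x₀ d0, ENNReal.ofReal (grd D u y)).toReal ≤ Φ 0 := by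
      apply ENNReal.toReal_mono (hfinS _)
      apply lintegral_mono_set
      refine ball_subset_closedBall.trans (closedBall_subset_closedBall' ?_)
      simp; linarith
    rw [hA0]
    refine b.trans ?_
    have hpos := hh0 0
    have hΦ00 := hΦ0 0
    have e1 : Φ 0 ≤ T ^ (2 * n) * a 0 := by
      simp only [ha, pow_zero, div_one]
      rw [← mul_assoc]
      refine le_mul_of_one_le_left hΦ00 ?_
      rw [← Real.rpow_natCast, ← Real.rpow_add (by linarith)]
      apply Real.one_le_rpow (by linarith)
      push_cast
      have hn' : (2 : ℝ) ≤ n := by exact_mod_cast hn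
      nlinarith
    calc _ ≤ (2 ^ (n + 1) * d0 * (4 * K) ^ n / ω) * Φ 0 := by
          refine mul_le_mul ?_ hΦle ENNReal.toReal_nonneg (by positivity)
          calc 2 ^ (n + 1) * d0 ^ (n + 1) / (h 0 ^ n * d0 ^ n * ω)
              ≤ 2 ^ (n + 1) * d0 ^ (n + 1) / ((1 / (4 * K)) ^ n * d0 ^ n * ω) := by gcongr
            _ = _ := by rw [div_pow, one_pow, pow_succ d0 n]; field_simp
      _ ≤ (2 ^ (n + 1) * d0 * (4 * K) ^ n / ω) * (T ^ (2 * n) * a 0) := by gcongr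
      _ = _ := by rw [hC2]; ring
  have htel : ∀ J, |A J - A 0| ≤ C1 * ∑ j ∈ Finset.range J, a j := by
    intro J
    induction J with
    | zero => simp
    | succ J ih =>
      rw [Finset.sum_range_succ, mul_add]
      have h1 := hstep J
      rw [abs_sub_comm] at h1
      have := abs_sub_le (A (J + 1)) (A J) (A 0)
      linarith
  have ha0 : a 0 ≤ S := by simpa using hS' 1
  have hJ : ∀ J, |A J - ⨍ y in ball x₀ d0, u y| ≤ (C1 + C2) * S := by
    intro J
    have h1 := htel J
    have h2 := mul_le_mul_of_nonneg_left (hS' J) hC10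
    have h3 := mul_le_mul_of_nonneg_left ha0 hC20
    have := abs_sub_le (A J) (A 0) (⨍ y in ball x₀ d0, u y)
    linarith
  refine le_of_forall_pos_le_add fun ε hε => ?_
  have hcx : ContinuousAt u x := (hu.continuousOn).continuousAt (hD.mem_nhds hx)
  obtain ⟨δ, hδ, hδu⟩ := Metric.continuousAt_iff.1 hcx ε hε
  obtain ⟨J, hJδ⟩ : ∃ J, 2 * τ J < δ := by
    have : Tendsto (fun J : ℕ => 2 * τ J) atTop (𝓝 (2 * 0)) := by
      apply Tendsto.const_mul
      exact tendsto_const_nhds.div_atTop (tendsto_pow_atTop_atTop_of_one_lt (by norm_num))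
    rw [mul_zero] at this
    exact ((tendsto_order.1 this).2 δ hδ).exists
  have hAJ : |A J - u x| ≤ ε := by
    have hτmem : τ J ∈ Icc (τ (J + 1)) (τ J) := ⟨(hmem J).2, le_rfl⟩
    apply avg_close u _ _ (hh0 J)
    · exact u_int D hD u hu hfin _ _ ((ball_subset_ball (by linarith [hh0 J])).trans (hsubD J _ hτmem))
    · intro y hy
      have h1 := hdist (τ J) ⟨(hτ0 J).le, hτT J⟩
      have h2 := hhτ J
      have h3 := hh0 J
      have h4 : dist y (γ (τ J)) < h J := hy
      have h5 := dist_triangle y (γ (τ J)) x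
      have := hδu (show dist y x < δ by linarith)
      exact this.le
  have := abs_sub_le (u x) (A J) (⨍ y in ball x₀ d0, u y)
  rw [abs_sub_comm] at hAJ
  linarith [hJ J]
end JSP


namespace JSP
open Set Filter Topology
open scoped ENNReal NNReal

lemma geo_aux (β : ℝ) (hβ0 : 0 < β) (hβ1 : β < 1) : ∀ (J : ℕ) (A : ℝ), 0 < A →
    (A ≤ 1 → ∑ j ∈ Finset.range J, min (A * β ^ j) (A * β ^ j)⁻¹ ≤ A / (1 - β)) ∧
    (1 < A → ∑ j ∈ Finset.range J, min (A * β ^ j) (A * β ^ j)⁻¹ ≤ (2 - β / A) / (1 - β)) := by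
  have h1β : 0 < 1 - β := by linarith
  intro J
  induction J with
  | zero =>
    intro A hA
    refine ⟨fun _ => by simpa using by positivity, fun h => ?_⟩
    have : β / A ≤ 1 := by rw [div_le_one hA]; linarith
    simp only [Finset.range_zero, Finset.sum_empty]
    exact div_nonneg (by linarith) h1β.le
  | succ J ih =>
    intro A hA
    have e : ∑ j ∈ Finset.range (J + 1), min (A * β ^ j) (A * β ^ j)⁻¹ =
        ∑ j ∈ Finset.range J, min ((A * β) * β ^ j) ((A * β) * β ^ j)⁻¹ + min A A⁻¹ := by
      rw [Finset.sum_range_succ']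
      simp only [pow_zero, mul_one, pow_succ', mul_assoc]
    rw [e]
    obtain ⟨i1, i2⟩ := ih (A * β) (by positivity)
    constructor
    · intro hA1
      have hAβ : A * β ≤ 1 := by nlinarith
      have h2 := i1 hAβ
      have h3 : min A A⁻¹ ≤ A := min_le_left _ _
      have : A / (1 - β) = A * β / (1 - β) + A := by field_simp; ring
      linarith
    · intro hA1
      have h3 : min A A⁻¹ ≤ A⁻¹ := min_le_right _ _
      have hi : A⁻¹ ≤ 1 := inv_le_one_of_one_le₀ hA1.le
      rcases le_or_gt (A * β) 1 with h | h
      · have h2 := i1 h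
        have h4 : A * β / (1 - β) ≤ 1 / (1 - β) := by gcongr
        have h5 : (2 - β / A) / (1 - β) = 1 / (1 - β) + A⁻¹ + (1 - A⁻¹) / (1 - β) := by
          field_simp; ring
        have h6 : 0 ≤ (1 - A⁻¹) / (1 - β) := div_nonneg (by linarith) h1β.le
        linarith
      · have h2 := i2 h
        have h5 : (2 - β / A) / (1 - β) = (2 - β / (A * β)) / (1 - β) + A⁻¹ := by
          field_simp; ring
        linarith

lemma geo_sum (β : ℝ) (hβ0 : 0 < β) (hβ1 : β < 1) (J : ℕ) (A : ℝ) (hA : 0 < A) :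
    ∑ j ∈ Finset.range J, min (A * β ^ j) (A * β ^ j)⁻¹ ≤ 2 / (1 - β) := by
  have h1β : 0 < 1 - β := by linarith
  obtain ⟨h1, h2⟩ := geo_aux β hβ0 hβ1 J A hA
  rcases le_or_gt A 1 with h | h
  · refine (h1 h).trans ?_
    gcongr; linarith
  · refine (h2 h).trans ?_
    gcongr
    have : 0 < β / A := by positivity
    linarith

lemma hed_sum (N p k θ C M G T : ℝ) (hN : 0 < N) (hp : 0 < p) (hθ : 0 < θ) (hC : 0 ≤ C) (hM : 0 < M)
    (hG : 0 < G) (hT : 0 < T) (hk : θ ≤ k) (hk2 : θ ≤ N / p - k) (a : ℕ → ℝ)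
    (ha1 : ∀ j, a j ≤ C * ((T / 2 ^ j) ^ k * M)) (ha2 : ∀ j, a j ≤ C * ((T / 2 ^ j) ^ (k - N / p) * G)) (J : ℕ) :
    ∑ j ∈ Finset.range J, a j ≤ C * (2 / (1 - 2 ^ (-θ))) * (M ^ (1 - p * k / N) * G ^ (p * k / N)) := by
  set ρ := (G / M) ^ (p / N) with hρ
  have hGM : 0 < G / M := by positivity
  have hρ0 : 0 < ρ := Real.rpow_pos_of_pos hGM _
  have hMρ : M ^ (1 - p * k / N) * G ^ (p * k / N) = M * ρ ^ k := by
    rw [hρ, ← Real.rpow_mul hGM.le, show p / N * k = p * k / N by ring, Real.div_rpow hG.le hM.le,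
      Real.rpow_sub hM, Real.rpow_one]
    ring
  have hG' : G = M * ρ ^ (N / p) := by
    rw [hρ, ← Real.rpow_mul hGM.le, show p / N * (N / p) = 1 by field_simp, Real.rpow_one]
    field_simp
  set β : ℝ := 2 ^ (-θ) with hβ
  have hβ0 : 0 < β := by positivity
  have hβ1 : β < 1 := Real.rpow_lt_one_of_one_lt_of_neg (by norm_num) (by linarith)
  set A := (T / ρ) ^ θ with hA
  have hA0 : 0 < A := by positivity
  have hAj : ∀ j : ℕ, A * β ^ j = ((T / 2 ^ j) / ρ) ^ θ := by
    intro j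
    rw [hA, hβ, ← Real.rpow_natCast, ← Real.rpow_mul (by norm_num), show T / 2 ^ j / ρ = (T / ρ) * (2 ^ j)⁻¹ by ring,
      Real.mul_rpow (by positivity) (by positivity), ← Real.rpow_natCast 2 j, ← Real.rpow_neg (by norm_num),
      ← Real.rpow_mul (by norm_num)]
    congr 2; ring
  have key : ∀ j, a j ≤ C * (M * ρ ^ k) * min (A * β ^ j) (A * β ^ j)⁻¹ := by
    intro j
    rw [hAj]
    have hτ : 0 < T / 2 ^ j := by positivity
    specialize ha1 j
    specialize ha2 j
    set τ := T / 2 ^ j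
    have hy : 0 < τ / ρ := by positivity
    have hτe : ∀ e : ℝ, τ ^ e = ρ ^ e * (τ / ρ) ^ e := by
      intro e
      rw [← Real.mul_rpow hρ0.le hy.le]; congr 1; field_simp
    rw [← Real.rpow_neg hy.le]
    rcases le_or_gt (τ / ρ) 1 with h | h
    · have h2 : (τ / ρ) ^ θ ≤ (τ / ρ) ^ (-θ) := Real.rpow_le_rpow_of_exponent_ge hy h (by linarith)
      rw [min_eq_left h2]
      refine ha1.trans ?_
      rw [hτe k, mul_assoc C, show ρ ^ k * (τ / ρ) ^ k * M = M * ρ ^ k * (τ / ρ) ^ k by ring]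
      have := Real.rpow_le_rpow_of_exponent_ge hy h hk
      gcongr
    · have h2 : (τ / ρ) ^ (-θ) ≤ (τ / ρ) ^ θ := Real.rpow_le_rpow_of_exponent_le h.le (by linarith)
      rw [min_eq_right h2]
      refine ha2.trans ?_
      rw [mul_assoc C, hτe, show ρ ^ (k - N / p) * (τ / ρ) ^ (k - N / p) * G = M * ρ ^ k * (τ / ρ) ^ (k - N / p) by
        rw [hG', Real.rpow_sub hρ0]
        have : ρ ^ (N / p) ≠ 0 := by positivity
        field_simp]
      have := Real.rpow_le_rpow_of_exponent_le h.le (show k - N / p ≤ -θ by linarith)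
      gcongr
  calc ∑ j ∈ Finset.range J, a j ≤ ∑ j ∈ Finset.range J, C * (M * ρ ^ k) * min (A * β ^ j) (A * β ^ j)⁻¹ :=
        Finset.sum_le_sum fun j _ => key j
    _ = C * (M * ρ ^ k) * ∑ j ∈ Finset.range J, min (A * β ^ j) (A * β ^ j)⁻¹ := by rw [Finset.mul_sum]
    _ ≤ C * (M * ρ ^ k) * (2 / (1 - β)) := by
        gcongr
        exact geo_sum β hβ0 hβ1 J A hA0
    _ = _ := by rw [hMρ]; ring

/-- volume constant -/
noncomputable def vC (n : ℕ) : ℝ := 1 + 2 ^ n * volume.real (ball (0 : EuclideanSpace ℝ (Fin n)) 1)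

lemma vC_ge (n : ℕ) : 1 ≤ vC n := by
  unfold vC
  have : 0 ≤ 2 ^ n * volume.real (ball (0 : EuclideanSpace ℝ (Fin n)) 1) := by positivity
  linarith

lemma vol_le {n : ℕ} (x : EuclideanSpace ℝ (Fin n)) (τ : ℝ) (hτ : 0 < τ) :
    volume (closedBall x (2 * τ)) ≤ ENNReal.ofReal (vC n * τ ^ n) := by
  rw [Measure.addHaar_closedBall _ _ (by positivity)]
  rw [← ENNReal.ofReal_toReal (measure_ball_lt_top (μ := volume) (x := (0 : EuclideanSpace ℝ (Fin n))) (r := 1)).ne,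
    ← ENNReal.ofReal_mul (by positivity)]
  apply ENNReal.ofReal_le_ofReal
  simp only [finrank_euclideanSpace, Fintype.card_fin, vC, measureReal_def]
  rw [mul_pow]
  have : 0 < τ ^ n := by positivity
  nlinarith

lemma term1 {n : ℕ} (F : EuclideanSpace ℝ (Fin n) → ℝ≥0∞) (R : ℕ → ℝ) (x : EuclideanSpace ℝ (Fin n))
    (τ : ℝ) (hτ : 0 < τ) (j : ℕ) (hj : R j = 2 * τ) (hM : maxFn R F x ≠ ∞) :
    (∫⁻ y in closedBall x (2 * τ), F y).toReal ≤ vC n * τ ^ n * (maxFn R F x).toReal := by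
  have h1 : (∫⁻ y in closedBall x (2 * τ), F y) / volume (closedBall x (2 * τ)) ≤ maxFn R F x := by
    rw [← hj]
    exact le_iSup (fun j => (∫⁻ y in closedBall x (R j), F y) / volume (closedBall x (R j))) j
  have h2 : (∫⁻ y in closedBall x (2 * τ), F y) ≤ maxFn R F x * volume (closedBall x (2 * τ)) := by
    rwa [ENNReal.div_le_iff (measure_closedBall_pos volume x (by positivity)).ne' measure_closedBall_lt_top.ne] at h1
  have h3 := h2.trans (mul_le_mul_right (vol_le x τ hτ) _)
  have hpos : 0 ≤ vC n * τ ^ n := by have := vC_ge n; positivity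
  have h4 := ENNReal.toReal_mono (ENNReal.mul_ne_top hM ENNReal.ofReal_ne_top) h3
  rw [ENNReal.toReal_mul, ENNReal.toReal_ofReal hpos] at h4
  linarith

lemma term2 {n : ℕ} (F : EuclideanSpace ℝ (Fin n) → ℝ≥0∞) (hF : Measurable F) (x : EuclideanSpace ℝ (Fin n))
    (τ : ℝ) (hτ : 0 < τ) (p G : ℝ) (hp : 1 < p) (hG : 0 ≤ G) (hFp : ∫⁻ y, F y ^ p ≤ ENNReal.ofReal (G ^ p)) :
    (∫⁻ y in closedBall x (2 * τ), F y).toReal ≤ vC n * τ ^ ((n : ℝ) - n / p) * G := by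
  have hpq := Real.HolderConjugate.conjExponent hp
  have h1 := ENNReal.lintegral_mul_le_Lp_mul_Lq (volume.restrict (closedBall x (2 * τ))) hpq
    hF.aemeasurable (aemeasurable_const (b := (1 : ℝ≥0∞)))
  simp only [Pi.mul_apply, mul_one, ENNReal.one_rpow, lintegral_one, Measure.restrict_apply_univ] at h1
  have hv := vC_ge n
  have h2 : (∫⁻ y in closedBall x (2 * τ), F y ^ p) ^ (1 / p) ≤ ENNReal.ofReal G := by
    calc _ ≤ (ENNReal.ofReal (G ^ p)) ^ (1 / p) := by
          apply ENNReal.rpow_le_rpow _ (by positivity)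
          exact (lintegral_mono' Measure.restrict_le_self le_rfl).trans hFp
      _ = ENNReal.ofReal G := by
          rw [← ENNReal.ofReal_rpow_of_nonneg hG (by linarith), ← ENNReal.rpow_mul, mul_one_div_cancel (by linarith),
            ENNReal.rpow_one]
  have hq0 : 0 < 1 / p.conjExponent := one_div_pos.2 hpq.symm.pos
  have hq : 1 / p.conjExponent = 1 - 1 / p := by
    have := hpq.inv_add_inv_eq_one
    rw [one_div, one_div]; linarith
  have h3 : volume (closedBall x (2 * τ)) ^ (1 / p.conjExponent) ≤ ENNReal.ofReal (vC n * τ ^ ((n : ℝ) - n / p)) := by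
    calc _ ≤ (ENNReal.ofReal (vC n * τ ^ n)) ^ (1 / p.conjExponent) :=
          ENNReal.rpow_le_rpow (vol_le x τ hτ) hq0.le
      _ = ENNReal.ofReal ((vC n * τ ^ n) ^ (1 / p.conjExponent)) := by
          rw [ENNReal.ofReal_rpow_of_nonneg (by positivity) hq0.le]
      _ ≤ _ := by
          apply ENNReal.ofReal_le_ofReal
          rw [Real.mul_rpow (by positivity) (by positivity), ← Real.rpow_natCast τ n, ← Real.rpow_mul hτ.le, hq,
            show (n : ℝ) * (1 - 1 / p) = n - n / p by ring]
          gcongr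
          calc vC n ^ (1 - 1 / p) ≤ vC n ^ (1 : ℝ) := by
                apply Real.rpow_le_rpow_of_exponent_le hv
                have : 0 < 1 / p := by positivity
                linarith
            _ = vC n := Real.rpow_one _
  have h4 := h1.trans (mul_le_mul' h2 h3)
  rw [← ENNReal.ofReal_mul hG] at h4
  have h5 := ENNReal.toReal_mono ENNReal.ofReal_ne_top h4
  rw [ENNReal.toReal_ofReal (by positivity)] at h5
  linarith
end JSP


namespace JSP
open Set Filter Topology
open scoped ENNReal NNReal

lemma ball_sub {n : ℕ} (D : Set (EuclideanSpace ℝ (Fin n))) (hD : IsOpen D)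
    (z : EuclideanSpace ℝ (Fin n)) (hz : z ∈ D) (r : ℝ) (hr : r ≤ infDist z (frontier D)) : ball z r ⊆ D := by
  rcases le_or_gt r 0 with h0 | h0
  · rw [ball_eq_empty.2 h0]; exact empty_subset _
  have hdis : Disjoint (ball z r) (frontier D) := by
    rw [Set.disjoint_left]
    intro y hy hyf
    have h1 := infDist_le_dist_of_mem (x := z) hyf
    rw [mem_ball, dist_comm] at hy
    linarith
  by_contra hcon
  obtain ⟨y, hy, hyD⟩ := Set.not_subset.1 hcon
  have hpre : IsPreconnected (ball z r) := (convex_ball z r).isPreconnected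
  have hcl : ∀ w ∈ ball z r, w ∉ D → w ∈ (closure D)ᶜ := by
    intro w hw hwD hwc
    apply Set.disjoint_left.1 hdis hw
    rw [frontier, hD.interior_eq]
    exact ⟨hwc, hwD⟩
  obtain ⟨w, _, hw1, hw2⟩ := hpre D (closure D)ᶜ hD isClosed_closure.isOpen_compl
    (fun w hw => by
      by_cases h : w ∈ D
      · exact Or.inl h
      · exact Or.inr (hcl w hw h)) ⟨z, mem_ball_self h0, hz⟩ ⟨y, hy, hcl y hy hyD⟩
  exact hw2 (subset_closure hw1)

lemma pointwise {n : ℕ} (hn : 2 ≤ n) (D : Set (EuclideanSpace ℝ (Fin n))) (hD : IsOpen D)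
    (u : EuclideanSpace ℝ (Fin n) → ℝ) (hu : DifferentiableOn ℝ u D)
    (hfin : ∫⁻ y, ENNReal.ofReal (grd D u y) ≠ ∞)
    (T K d0 s : ℝ) (hT : 2 ≤ T) (hK : T ^ 2 ≤ K) (hd0 : 0 < d0) (hKd : T ^ 2 ≤ K * d0) (hdT : d0 ≤ T)
    (hs1 : 1 ≤ s) (hs2 : s ≤ 2)
    (x x₀ : EuclideanSpace ℝ (Fin n)) (hx : x ∈ D) (hB : ball x₀ d0 ⊆ D)
    (γ : ℝ → EuclideanSpace ℝ (Fin n)) (hγ : ContinuousOn γ (Icc 0 T)) (hγT : γ T = x₀)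
    (hdist : ∀ t ∈ Icc 0 T, dist (γ t) x ≤ t)
    (hball : ∀ t ∈ Ioc 0 T, ball (γ t) (t ^ s / K) ⊆ D)
    (p θ G : ℝ) (hp : 1 < p) (hθ : 0 < θ) (hG : 0 < G)
    (hθ1 : θ ≤ n - s * ((n : ℝ) - 1)) (hθ2 : θ ≤ n / p - (n - s * ((n : ℝ) - 1)))
    (hFp : ∫⁻ y, ENNReal.ofReal (grd D u y) ^ p ≤ ENNReal.ofReal (G ^ p))
    (hM : maxFn (fun j => 2 * (T / 2 ^ j)) (fun y => ENNReal.ofReal (grd D u y)) x ≠ ∞) :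
    |u x - ⨍ y in ball x₀ d0, u y| ≤ chC n T K d0 * (vC n * (2 / (1 - 2 ^ (-θ)))) *
      (((maxFn (fun j => 2 * (T / 2 ^ j)) (fun y => ENNReal.ofReal (grd D u y)) x).toReal + G) ^
        (1 - p * (n - s * ((n : ℝ) - 1)) / n) * G ^ (p * (n - s * ((n : ℝ) - 1)) / n)) := by
  set M := maxFn (fun j => 2 * (T / 2 ^ j)) (fun y => ENNReal.ofReal (grd D u y)) x with hMd
  have hM0 : 0 ≤ M.toReal := ENNReal.toReal_nonneg
  have hv := vC_ge n
  have hn0 : (0 : ℝ) < n := by positivity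
  have hmeas : Measurable (fun y => ENNReal.ofReal (grd D u y)) := (grd_meas D hD u).ennreal_ofReal
  rw [mul_assoc]
  apply chain hn D hD u hu hfin T K d0 s hT hK hd0 hKd hdT hs1 hs2 x x₀ hx hB γ hγ hγT hdist hball
  intro J
  apply hed_sum n p (n - s * ((n : ℝ) - 1)) θ (vC n) (M.toReal + G) G T hn0 (by linarith) hθ (by linarith)
    (by linarith) hG (by linarith) hθ1 hθ2
  · intro j
    have hτ : 0 < T / 2 ^ j := by positivity
    have h := term1 (fun y => ENNReal.ofReal (grd D u y)) (fun j => 2 * (T / 2 ^ j)) x (T / 2 ^ j) hτ j rfl hM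
    rw [← hMd] at h
    set τ := T / 2 ^ j
    calc _ ≤ τ ^ (-(s * ((n : ℝ) - 1))) * (vC n * τ ^ n * (M.toReal + G)) := by
          refine mul_le_mul_of_nonneg_left (h.trans ?_) (by positivity)
          gcongr
          linarith
      _ = _ := by
          rw [show (n : ℝ) - s * ((n : ℝ) - 1) = -(s * ((n : ℝ) - 1)) + n by ring, Real.rpow_add hτ, Real.rpow_natCast]
          ring
  · intro j
    have hτ : 0 < T / 2 ^ j := by positivity
    have h := term2 (fun y => ENNReal.ofReal (grd D u y)) hmeas x (T / 2 ^ j) hτ p G hp hG.le hFp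
    set τ := T / 2 ^ j
    calc _ ≤ τ ^ (-(s * ((n : ℝ) - 1))) * (vC n * τ ^ ((n : ℝ) - n / p) * G) :=
          mul_le_mul_of_nonneg_left h (by positivity)
      _ = _ := by
          rw [show (n : ℝ) - s * ((n : ℝ) - 1) - n / p = -(s * ((n : ℝ) - 1)) + (n - n / p) by ring, Real.rpow_add hτ]
          ring

/-- pointwise modular bound -/
lemma modular_pt (N p k C c M G q v : ℝ) (hN : 0 < N) (hp : 1 < p) (hk : 0 < k) (hpk : p * k < N)
    (hq : q = N * p / (N - p * k)) (hC : 0 < C) (hc : C ≤ c)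
    (hM : 0 ≤ M) (hG : 0 < G) (hv0 : 0 ≤ v) (hv : v ≤ C * ((M + G) ^ (1 - p * k / N) * G ^ (p * k / N))) :
    (v / (c * G)) ^ q ≤ C / c * ((M + G) / G) ^ p := by
  have hc0 : 0 < c := hC.trans_le hc
  have hden : 0 < N - p * k := by linarith
  have hpk0 : 0 < p * k := by positivity
  have hq1 : 1 ≤ q := by
    rw [hq, le_div_iff₀ hden]; nlinarith
  have hMG : 0 < M + G := by linarith
  have h1 : v / (c * G) ≤ C / c * ((M + G) / G) ^ (1 - p * k / N) := by
    rw [div_le_iff₀ (by positivity)]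
    refine hv.trans (le_of_eq ?_)
    rw [Real.div_rpow hMG.le hG.le, show G ^ (p * k / N) = G / G ^ (1 - p * k / N) by
      rw [eq_div_iff (by positivity), ← Real.rpow_add hG]; simp]
    field_simp
  calc (v / (c * G)) ^ q ≤ (C / c * ((M + G) / G) ^ (1 - p * k / N)) ^ q :=
        Real.rpow_le_rpow (by positivity) h1 (by linarith)
    _ = (C / c) ^ q * ((M + G) / G) ^ p := by
        rw [Real.mul_rpow (by positivity) (by positivity), ← Real.rpow_mul (by positivity)]
        congr 2
        rw [hq]; field_simp
    _ ≤ C / c * ((M + G) / G) ^ p := by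
        gcongr
        calc (C / c) ^ q ≤ (C / c) ^ (1 : ℝ) := Real.rpow_le_rpow_of_exponent_ge (by positivity)
              ((div_le_one hc0).2 hc) hq1
          _ = _ := Real.rpow_one _

/-- integrated bound -/
lemma modular_int {n : ℕ} (D : Set (EuclideanSpace ℝ (Fin n)))
    (f : EuclideanSpace ℝ (Fin n) → ℝ≥0∞) (M : EuclideanSpace ℝ (Fin n) → ℝ≥0∞) (hMm : Measurable M)
    (p C c A V G : ℝ) (hp : 1 < p) (hC : 0 < C) (hG : 0 < G) (hA : 0 ≤ A) (hV : 0 ≤ V)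
    (hc : c = C * (1 + 2 ^ (p - 1) * (A + V)))
    (hMp : ∫⁻ x, M x ^ p ≤ ENNReal.ofReal A * ENNReal.ofReal (G ^ p))
    (hDm : MeasurableSet D)
    (hDV : volume D ≤ ENNReal.ofReal V)
    (hf : ∀ x ∈ D, M x ≠ ∞ → f x ≤ ENNReal.ofReal (C / c * (((M x).toReal + G) / G) ^ p)) :
    ∫⁻ x in D, f x ≤ 1 := by
  have hc0 : 0 < c := by rw [hc]; positivity
  have hG' : ENNReal.ofReal G ≠ 0 := by simpa using hG
  have hpt : ∀ x ∈ D, f x ≤ ENNReal.ofReal (C / c * 2 ^ (p - 1)) * (ENNReal.ofReal ((G ^ p)⁻¹) * M x ^ p + 1) := by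
    intro x hx
    have hpos : 0 < C / c * 2 ^ (p - 1) := by positivity
    by_cases hM : M x = ∞
    · rw [hM, ENNReal.top_rpow_of_pos (by linarith), ENNReal.mul_top (by
        simp only [ne_eq, ENNReal.ofReal_eq_zero, not_le]; positivity), top_add, ENNReal.mul_top (by
        simp only [ne_eq, ENNReal.ofReal_eq_zero, not_le]; exact hpos)]
      exact le_top
    · refine (hf x hx hM).trans ?_
      have hm : 0 ≤ (M x).toReal := ENNReal.toReal_nonneg
      conv_rhs => rw [← ENNReal.ofReal_toReal hM]
      set m := (M x).toReal
      rw [ENNReal.ofReal_rpow_of_nonneg hm (by linarith), ← ENNReal.ofReal_mul (by positivity), ← ENNReal.ofReal_one,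
        ← ENNReal.ofReal_add (by positivity) (by norm_num), ← ENNReal.ofReal_mul (by positivity)]
      apply ENNReal.ofReal_le_ofReal
      rw [mul_assoc]
      refine mul_le_mul_of_nonneg_left ?_ (by positivity)
      have : (m / G + 1) ^ p ≤ 2 ^ (p - 1) * ((m / G) ^ p + 1 ^ p) := by
        exact_mod_cast NNReal.rpow_add_le_mul_rpow_add_rpow ⟨m / G, by positivity⟩ 1 hp.le
      rw [show (m + G) / G = m / G + 1 by field_simp]
      refine this.trans (le_of_eq ?_)
      rw [Real.div_rpow hm hG.le, Real.one_rpow]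
      ring
  calc ∫⁻ x in D, f x ≤ ∫⁻ x in D, ENNReal.ofReal (C / c * 2 ^ (p - 1)) * (ENNReal.ofReal ((G ^ p)⁻¹) * M x ^ p + 1) :=
        setLIntegral_mono' hDm hpt
    _ = ENNReal.ofReal (C / c * 2 ^ (p - 1)) * (ENNReal.ofReal ((G ^ p)⁻¹) * (∫⁻ x in D, M x ^ p) + volume D) := by
        rw [lintegral_const_mul _ (by fun_prop), lintegral_add_right _ measurable_const,
          lintegral_const_mul _ (by fun_prop)]
        simp
    _ ≤ ENNReal.ofReal (C / c * 2 ^ (p - 1)) *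
        (ENNReal.ofReal ((G ^ p)⁻¹) * (ENNReal.ofReal A * ENNReal.ofReal (G ^ p)) + ENNReal.ofReal V) := by
        gcongr
        exact (lintegral_mono' Measure.restrict_le_self le_rfl).trans hMp
    _ = ENNReal.ofReal (C / c * 2 ^ (p - 1) * (A + V)) := by
        rw [← ENNReal.ofReal_mul hA, ← ENNReal.ofReal_mul (by positivity),
          ← ENNReal.ofReal_add (by positivity) hV, ← ENNReal.ofReal_mul (by positivity)]
        congr 2
        field_simp
    _ ≤ ENNReal.ofReal 1 := by
        apply ENNReal.ofReal_le_ofReal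
        rw [div_mul_eq_mul_div, div_mul_eq_mul_div, div_le_one hc0, hc]
        nlinarith
    _ = 1 := ENNReal.ofReal_one
end JSP

namespace JSP
open Set Filter Topology
open scoped ENNReal NNReal

/-- extended John curve -/
lemma john_curve {n : ℕ} (D : Set (EuclideanSpace ℝ (Fin n))) (s : EuclideanSpace ℝ (Fin n) → ℝ) (a b : ℝ)
    (x₀ : EuclideanSpace ℝ (Fin n)) (hJ : IsJohnDomain D s a b x₀) (d0 T K : ℝ)
    (hd : d0 = infDist x₀ (frontier D)) (hd0 : 0 < d0) (hT : 2 ≤ T) (hbT : b ≤ T) (hK0 : 0 < K) (hKb : b / a ≤ K)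
    (hKd : T ^ 2 ≤ K * d0) (x : EuclideanSpace ℝ (Fin n)) (hx : x ∈ D) (hs1 : 1 ≤ s x) (hs2 : s x ≤ 2) :
    ∃ γ : ℝ → EuclideanSpace ℝ (Fin n), ContinuousOn γ (Icc 0 T) ∧ γ T = x₀ ∧
      (∀ t ∈ Icc 0 T, dist (γ t) x ≤ t) ∧ (∀ t ∈ Ioc 0 T, ball (γ t) (t ^ s x / K) ⊆ D) := by
  obtain ⟨hDo, hDc, hDb, ha, hab, hx₀, hcur⟩ := hJ
  obtain ⟨ℓ, hℓ0, hℓb, γ, hγ0, hγℓ, hlip, hγD, hγJ⟩ := hcur x hx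
  have hmin : ∀ t, 0 ≤ t → min t ℓ ∈ Icc 0 ℓ := fun t ht => ⟨le_min ht hℓ0, min_le_right _ _⟩
  refine ⟨fun t => γ (min t ℓ), ?_, ?_, ?_, ?_⟩
  · exact hlip.continuousOn.comp (by fun_prop) fun t ht => hmin t ht.1
  · simp only [min_eq_right (hℓb.trans hbT), hγℓ]
  · intro t ht
    have h := hlip.dist_le_mul _ (hmin t ht.1) 0 ⟨le_rfl, hℓ0⟩
    rw [hγ0] at h
    refine h.trans ?_
    rw [Real.dist_eq, sub_zero, abs_of_nonneg (hmin t ht.1).1]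
    simp
  · intro t ht
    have hmt := hmin t ht.1.le
    apply ball_sub D hDo _ (hγD _ hmt)
    rw [div_le_iff₀ hK0]
    rcases le_or_gt t ℓ with h | h
    · simp only [min_eq_left h] at hmt ⊢
      refine (hγJ t hmt).trans ?_
      rw [mul_comm]
      gcongr
      exact infDist_nonneg
    · simp only [min_eq_right h.le, hγℓ, ← hd]
      calc t ^ s x ≤ T ^ s x := Real.rpow_le_rpow ht.1.le ht.2 (by linarith)
        _ ≤ T ^ (2 : ℝ) := Real.rpow_le_rpow_of_exponent_le (by linarith) hs2
        _ = T ^ 2 := by norm_cast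
        _ ≤ d0 * K := by linarith

lemma grd_pow {n : ℕ} (D : Set (EuclideanSpace ℝ (Fin n))) (hD : IsOpen D) (u : EuclideanSpace ℝ (Fin n) → ℝ) (p : ℝ)
    (hp : 1 < p) (hi : IntegrableOn (fun y => ‖fderiv ℝ u y‖ ^ p) D) :
    ∫⁻ y, ENNReal.ofReal (grd D u y) ^ p = ENNReal.ofReal (∫ y in D, ‖fderiv ℝ u y‖ ^ p) := by
  rw [ofReal_integral_eq_lintegral_ofReal hi (Eventually.of_forall fun y => by positivity),
    ← lintegral_indicator hD.measurableSet]
  congr 1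
  ext y
  by_cases hy : y ∈ D
  · simp only [grd, indicator_of_mem hy]
    rw [ENNReal.ofReal_rpow_of_nonneg (norm_nonneg _) (by linarith)]
  · simp only [grd, indicator_of_notMem hy]
    rw [ENNReal.ofReal_zero, ENNReal.zero_rpow_of_pos (by linarith)]

lemma grd_fin {n : ℕ} (D : Set (EuclideanSpace ℝ (Fin n))) (hD : IsOpen D) (hb : Bornology.IsBounded D)
    (u : EuclideanSpace ℝ (Fin n) → ℝ) (p : ℝ)
    (hp : 1 < p) (hi : IntegrableOn (fun y => ‖fderiv ℝ u y‖ ^ p) D) :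
    ∫⁻ y, ENNReal.ofReal (grd D u y) ≠ ∞ := by
  have h1 : ∫⁻ y, ENNReal.ofReal (grd D u y) ≤ ∫⁻ y, (D.indicator 1 y + ENNReal.ofReal (grd D u y) ^ p) := by
    apply lintegral_mono
    intro y
    by_cases hy : y ∈ D
    · simp only [indicator_of_mem hy, Pi.one_apply]
      rcases le_total (ENNReal.ofReal (grd D u y)) 1 with h | h
      · exact h.trans le_self_add
      · refine le_trans ?_ le_add_self
        conv_lhs => rw [← ENNReal.rpow_one (ENNReal.ofReal (grd D u y))]
        exact ENNReal.rpow_le_rpow_of_exponent_le h hp.le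
    · simp [grd, indicator_of_notMem hy]
  refine (h1.trans_lt ?_).ne
  rw [lintegral_add_left (measurable_one.indicator hD.measurableSet), grd_pow D hD u p hp hi,
    lintegral_indicator_one hD.measurableSet]
  exact ENNReal.add_lt_top.2 ⟨hb.measure_lt_top, ENNReal.ofReal_lt_top⟩

lemma chC_nonneg (n : ℕ) (T K d0 : ℝ) (hT : 0 ≤ T) (hK : 0 ≤ K) (hd : 0 ≤ d0) : 0 ≤ chC n T K d0 := by
  unfold chC; positivity

end JSP

set_option maxHeartbeats 1000000

open JSP

/-- Sobolev–Poincaré inequality in `s(·)`-John domains, case `p > 1`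
(Theorem 5.6). -/
theorem john_sobolev_poincare_p_gt_one {n : ℕ} (hn : 2 ≤ n)
    (D : Set (EuclideanSpace ℝ (Fin n)))
    (s : EuclideanSpace ℝ (Fin n) → ℝ) (a b : ℝ)
    (x₀ : EuclideanSpace ℝ (Fin n))
    (hD : IsJohnDomain D s a b x₀)
    (sm sp : ℝ) (hsm : 1 ≤ sm) (hsp : sp < (n : ℝ) / ((n : ℝ) - 1))
    (hsb : ∀ x ∈ D, sm ≤ s x ∧ s x ≤ sp)
    (p : ℝ) (hp1 : 1 < p) (hp2 : p < (n : ℝ) / ((n : ℝ) - sm * ((n : ℝ) - 1))) :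
    ∃ c : ℝ, 0 < c ∧
      ∀ u : EuclideanSpace ℝ (Fin n) → ℝ, DifferentiableOn ℝ u D →
        LocallyIntegrableOn u D →
        IntegrableOn (fun y => ‖fderiv ℝ u y‖ ^ p) D →
        luxNorm (fun x => (n : ℝ) * p / (p * n * (s x - 1) + n - s x * p)) D
            (fun x =>
              u x - ⨍ y in Metric.ball x₀ (Metric.infDist x₀ (frontier D)), u y)
          ≤ c * (∫ y in D, ‖fderiv ℝ u y‖ ^ p) ^ (1 / p) := by
  obtain ⟨hDo, hDc, hDb, ha, hab, hx₀, -⟩ := id hD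
  have hn2 : (2 : ℝ) ≤ n := by exact_mod_cast hn
  have hn0 : (0 : ℝ) < n := by linarith
  have hn1 : (0 : ℝ) < n - 1 := by linarith
  have hsx := hsb x₀ hx₀
  have hspn : sp * ((n : ℝ) - 1) < n := by rwa [lt_div_iff₀ hn1] at hsp
  have hsmsp : sm ≤ sp := hsx.1.trans hsx.2
  have hkm : 0 < (n : ℝ) - sm * (n - 1) := by nlinarith
  have hpk : p * ((n : ℝ) - sm * (n - 1)) < n := by rwa [lt_div_iff₀ hkm] at hp2
  have hsp2 : sp ≤ 2 := by nlinarith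
  set d0 := Metric.infDist x₀ (frontier D) with hd0def
  have : Nonempty (Fin n) := ⟨⟨0, by omega⟩⟩
  have hfr : (frontier D).Nonempty := by
    rw [nonempty_frontier_iff]
    refine ⟨⟨x₀, hx₀⟩, ?_⟩
    rintro h
    rw [h] at hDb
    exact NormedSpace.unbounded_univ ℝ (EuclideanSpace ℝ (Fin n)) hDb
  have hd0 : 0 < d0 := by
    rw [hd0def, ← isClosed_frontier.notMem_iff_infDist_pos hfr]
    intro h
    have := hDo.inter_frontier_eq
    exact (Set.eq_empty_iff_forall_notMem.1 this) x₀ ⟨hx₀, h⟩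
  have hb0 : 0 < b := ha.trans_le hab
  set T : ℝ := 2 + b + d0 with hT
  set K : ℝ := b / a + T ^ 2 / d0 + T ^ 2 with hK
  have hT2 : 2 ≤ T := by linarith
  have hTd : 0 < T ^ 2 / d0 := by positivity
  have hba : 0 < b / a := by positivity
  have hKT : T ^ 2 ≤ K := by linarith
  have hK0 : 0 < K := by positivity
  have hKd : T ^ 2 ≤ K * d0 := by
    have : T ^ 2 / d0 * d0 ≤ K * d0 := by gcongr; nlinarith
    rwa [div_mul_cancel₀ _ hd0.ne'] at this
  set θ : ℝ := min (n - sp * ((n : ℝ) - 1)) (n / p - (n - sm * ((n : ℝ) - 1))) with hθ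
  have hp0 : 0 < p := by linarith
  have hθ0 : 0 < θ := by
    apply lt_min (by linarith)
    have : (n : ℝ) - sm * (n - 1) < n / p := by rw [lt_div_iff₀ hp0]; linarith
    linarith
  set C : ℝ := chC n T K d0 * (vC n * (2 / (1 - 2 ^ (-θ)))) + 1 with hC
  have h2θ : (2 : ℝ) ^ (-θ) < 1 := Real.rpow_lt_one_of_one_lt_of_neg (by norm_num) (by linarith)
  have hC' : 0 ≤ chC n T K d0 * (vC n * (2 / (1 - 2 ^ (-θ)))) := by
    have h1 := chC_nonneg n T K d0 (by linarith) hK0.le hd0.le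
    have h2 := vC_ge n
    have h3 : 0 < 1 - (2 : ℝ) ^ (-θ) := by linarith
    positivity
  have hC0 : 0 < C := by linarith
  set A : ℝ := p * 5 ^ n * 2 * 2 ^ (p - 1) / (p - 1) with hA
  have hA0 : 0 ≤ A := by
    have : 0 < p - 1 := by linarith
    positivity
  set V : ℝ := (volume D).toReal with hV
  have hV0 : 0 ≤ V := ENNReal.toReal_nonneg
  set c : ℝ := C * (1 + 2 ^ (p - 1) * (A + V)) with hc
  have hCc : C ≤ c := by
    rw [hc]
    refine le_mul_of_one_le_right hC0.le ?_
    have : 0 ≤ 2 ^ (p - 1) * (A + V) := by positivity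
    linarith
  have hc0 : 0 < c := hC0.trans_le hCc
  refine ⟨c, hc0, fun u hu _ hi => ?_⟩
  have hfin := grd_fin D hDo hDb u p hp1 hi
  have hpow := grd_pow D hDo u p hp1 hi
  set I := ∫ y in D, ‖fderiv ℝ u y‖ ^ p with hI
  have hI0 : 0 ≤ I := integral_nonneg fun y => by positivity
  have hG0 : 0 ≤ I ^ (1 / p) := by positivity
  refine le_of_forall_pos_le_add fun ε hε => ?_
  set G := I ^ (1 / p) + ε / c with hG
  have hεc : 0 < ε / c := by positivity
  have hGpos : 0 < G := by linarith
  have hGI : I ≤ G ^ p := by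
    calc I = (I ^ (1 / p)) ^ p := by rw [← Real.rpow_mul hI0, one_div_mul_cancel hp0.ne', Real.rpow_one]
      _ ≤ G ^ p := Real.rpow_le_rpow hG0 (by linarith) hp0.le
  have hcG : c * I ^ (1 / p) + ε = c * G := by rw [hG]; field_simp
  rw [hcG]
  have hFp : ∫⁻ y, ENNReal.ofReal (grd D u y) ^ p ≤ ENNReal.ofReal (G ^ p) := by
    rw [hpow]; exact ENNReal.ofReal_le_ofReal hGI
  have hmeas : Measurable (fun y => ENNReal.ofReal (grd D u y)) := (grd_meas D hDo u).ennreal_ofReal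
  have hstrong := strong_type (n := n) (fun j => 2 * (T / 2 ^ j)) (2 * T) (fun j => by positivity)
    (fun j => by
      have : T / 2 ^ j ≤ T := div_le_self (by linarith) (one_le_pow₀ (by norm_num))
      linarith) p hp1 (grd D u) (grd_meas D hDo u) (grd_nonneg D u) hfin
  unfold luxNorm
  refine csInf_le ⟨0, fun l hl => hl.1.le⟩ ⟨by positivity, ?_⟩
  refine modular_int D _ (maxFn (fun j => 2 * (T / 2 ^ j)) (fun y => ENNReal.ofReal (grd D u y)))
    (maxFn_measurable _ _ hmeas) p C c A V G hp1 hC0 hGpos hA0 hV0 hc (hstrong.trans ?_) hDo.measurableSet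
    (by rw [hV, ENNReal.ofReal_toReal hDb.measure_lt_top.ne]) ?_
  · exact mul_le_mul' le_rfl hFp
  · intro x hx hM
    apply ENNReal.ofReal_le_ofReal
    obtain ⟨hs1, hs2⟩ := hsb x hx
    obtain ⟨γ, hγ, hγT, hdist, hball⟩ := john_curve D s a b x₀ hD d0 T K rfl hd0 hT2 (by linarith) hK0
      (by linarith [sq_nonneg T]) hKd x hx (by linarith) (by linarith)
    have hθ1 : θ ≤ n - s x * ((n : ℝ) - 1) := (min_le_left _ _).trans (sub_le_sub_left (mul_le_mul_of_nonneg_right hs2 hn1.le) _)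
    have hθ2 : θ ≤ n / p - (n - s x * ((n : ℝ) - 1)) := (min_le_right _ _).trans (sub_le_sub_left (sub_le_sub_left (mul_le_mul_of_nonneg_right hs1 hn1.le) _) _)
    have hpt := pointwise hn D hDo u hu hfin T K d0 (s x) hT2 hKT hd0 hKd (by linarith) (by linarith) (by linarith)
      x x₀ hx (ball_sub D hDo x₀ hx₀ d0 le_rfl) γ hγ hγT hdist hball p θ G hp1 hθ0 hGpos hθ1 hθ2 hFp hM
    have hpkx : p * ((n : ℝ) - s x * ((n : ℝ) - 1)) < n := by
      refine lt_of_le_of_lt ?_ hpk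
      gcongr
    refine modular_pt n p (n - s x * ((n : ℝ) - 1)) C c _ G _ _ hn0 hp1 (by linarith) hpkx ?_ hC0 hCc
      ENNReal.toReal_nonneg hGpos (abs_nonneg _) (hpt.trans ?_)
    · congr 1; ring
    · gcongr
      linarith
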